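/- The fundamental group π₁𝒫𝒰ℛ_n of the ordered untwisted ring space is isomorphic to the group with presentation having generators α_{ij} for 1 ≤ i, j ≤ n with i ≠ j, and relations α_{ij}α_{kℓ} = α_{kℓ}α_{ij}, α_{ik}α_{jk} = α_{jk}α_{ik}, and α_{ij}α_{ik}α_{jk} = α_{jk}α_{ik}α_{ij}, where distinct index symbols denote distinct numbers in {1,…,n}. -/

import Mathlib

noncomputable section

open CategoryTheory

abbrev E2 : Type := EuclideanSpace ℝ (Fin 2)
abbrev E3 : Type := EuclideanSpace ℝ (Fin 3)

/-- The round circle in `ℝ³` with center `c`, radius `r` and normal `v`. -/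
def circleSet (c : E3) (r : ℝ) (v : E3) : Set E3 :=
  {x | ‖x - c‖ = r ∧ inner ℝ (x - c) v = (0 : ℝ)}

/-- The spanning disk of the round circle with center `c`, radius `r` and normal `v`. -/
def diskSet (c : E3) (r : ℝ) (v : E3) : Set E3 :=
  {x | ‖x - c‖ ≤ r ∧ inner ℝ (x - c) v = (0 : ℝ)}

/-- The circle determined by a parameter pair (center, normal vector `w`):
it has radius `‖w‖` and unit normal `w / ‖w‖` (so `w` and `-w` give the same circle). -/
def pCircle (p : E3 × E3) : Set E3 := circleSet p.1 ‖p.2‖ p.2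

/-- The spanning disk of the circle determined by a parameter pair. -/
def pDisk (p : E3 × E3) : Set E3 := diskSet p.1 ‖p.2‖ p.2

/-- The first circle meets the spanning disk of the second in exactly one point. -/
def LinksOnce (p q : E3 × E3) : Prop := ∃! x, x ∈ pCircle p ∩ pDisk q

/-- Two round circles are unlinked if neither meets the spanning disk of the other in
exactly one point. -/
def UnlinkedPair (p q : E3 × E3) : Prop := ¬ LinksOnce p q ∧ ¬ LinksOnce q p

/-- An `n`-tuple of parameters of (nondegenerate) pairwise disjoint, pairwise unlinked
round circles. -/
def IsRingTuple {n : ℕ} (f : Fin n → E3 × E3) : Prop :=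
  (∀ i, (f i).2 ≠ 0) ∧
  (∀ i j, i ≠ j → Disjoint (pCircle (f i)) (pCircle (f j))) ∧
  (∀ i j, i ≠ j → UnlinkedPair (f i) (f j))

/-- The space of ordered `n`-tuples of disjoint pairwise unlinked round circles. -/
abbrev RingTuple (n : ℕ) : Type := {f : Fin n → E3 × E3 // IsRingTuple f}

/-- Two tuples are identified iff they determine the same `n`-element set of circles
(this identifies `w` with `-w` and permutes the circles). -/
def ringSetoid (n : ℕ) : Setoid (RingTuple n) where
  r f g := (Set.range fun i => pCircle (f.1 i)) = Set.range fun i => pCircle (g.1 i)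
  iseqv := ⟨fun _ => rfl, Eq.symm, Eq.trans⟩

/-- The space `ℛ_n` of configurations of `n` disjoint pairwise unlinked round circles
in `ℝ³`, with the quotient topology. -/
abbrev RingConf (n : ℕ) : Type := Quotient (ringSetoid n)

/-- All circles of the tuple lie in planes parallel to the `yz`-plane, i.e. every
normal vector is parallel to `(1,0,0)`. -/
def IsUntwistedTuple {n : ℕ} (f : RingTuple n) : Prop :=
  ∀ i, (f.1 i).2 1 = 0 ∧ (f.1 i).2 2 = 0

/-- All circles of the tuple lie in vertical planes, i.e. every normal vector is
horizontal (third coordinate zero). -/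
def IsVerticalTuple {n : ℕ} (f : RingTuple n) : Prop := ∀ i, (f.1 i).2 2 = 0

/-- The untwisted ring space `𝒰ℛ_n ⊆ ℛ_n`: configurations of rings parallel to the
`yz`-plane. -/
def URConf (n : ℕ) : Set (RingConf n) :=
  {x | ∃ f, Quotient.mk (ringSetoid n) f = x ∧ IsUntwistedTuple f}

/-- The vertical ring space `𝒱ℛ_n ⊆ ℛ_n`: configurations of rings in vertical planes. -/
def VRConf (n : ℕ) : Set (RingConf n) :=
  {x | ∃ f, Quotient.mk (ringSetoid n) f = x ∧ IsVerticalTuple f}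

/-- The ordered (labeled) untwisted ring space `𝒫𝒰ℛ_n`: ordered `n`-tuples of pairwise
disjoint pairwise unlinked round circles parallel to the `yz`-plane. -/
abbrev PURTuple (n : ℕ) : Type := {f : RingTuple n // IsUntwistedTuple f}

/-- Generators `α_{ij}`, `i ≠ j`. -/
abbrev AGen (n : ℕ) : Type := {p : Fin n × Fin n // p.1 ≠ p.2}

/-- The generator `α_{ij}`. -/
def gα {n : ℕ} (i j : Fin n) (h : i ≠ j) : FreeGroup (AGen n) := FreeGroup.of ⟨(i, j), h⟩

/-- The relations `α_{ij}α_{kℓ} = α_{kℓ}α_{ij}`, `α_{ik}α_{jk} = α_{jk}α_{ik}` and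
`α_{ij}α_{ik}α_{jk} = α_{jk}α_{ik}α_{ij}` (distinct symbols denoting distinct indices),
written as relators. -/
def purRels (n : ℕ) : Set (FreeGroup (AGen n)) :=
  (⋃ (i : Fin n) (j : Fin n) (k : Fin n) (l : Fin n) (hij : i ≠ j) (hkl : k ≠ l)
      (_ : i ≠ k) (_ : i ≠ l) (_ : j ≠ k) (_ : j ≠ l),
    {gα i j hij * gα k l hkl * (gα k l hkl * gα i j hij)⁻¹}) ∪
  (⋃ (i : Fin n) (j : Fin n) (k : Fin n) (hik : i ≠ k) (hjk : j ≠ k) (_ : i ≠ j),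
    {gα i k hik * gα j k hjk * (gα j k hjk * gα i k hik)⁻¹}) ∪
  (⋃ (i : Fin n) (j : Fin n) (k : Fin n) (hij : i ≠ j) (hik : i ≠ k) (hjk : j ≠ k),
    {gα i j hij * gα i k hik * gα j k hjk * (gα j k hjk * gα i k hik * gα i j hij)⁻¹})

namespace AbsCover
open Topology unitInterval Set

variable {X : Type} [TopologicalSpace X] {ι : Type} (U : ι → Set X)

/-- A path inside `U i` between two points. -/
def kap (hU : ∀ i, IsSimplyConnected (U i)) (i : ι) {x y : X} (hx : x ∈ U i) (hy : y ∈ U i) :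
    Path.Homotopic.Quotient x y :=
  .mk (((hU i).isPathConnected.joinedIn x hx y hy).somePath)

theorem homotopic_of_mem {S : Set X} (hS : IsSimplyConnected S) {x y : X} (γ γ' : Path x y)
    (h : ∀ t, γ t ∈ S) (h' : ∀ t, γ' t ∈ S) : γ.Homotopic γ' := by
  have := hS.simplyConnectedSpace
  have hx : x ∈ S := by simpa using h 0
  have hy : y ∈ S := by simpa using h 1
  let δ : Path (⟨x, hx⟩ : S) ⟨y, hy⟩ :=
    { toFun := fun t => ⟨γ t, h t⟩
      continuous_toFun := by fun_prop
      source' := by simp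
      target' := by simp }
  let δ' : Path (⟨x, hx⟩ : S) ⟨y, hy⟩ :=
    { toFun := fun t => ⟨γ' t, h' t⟩
      continuous_toFun := by fun_prop
      source' := by simp
      target' := by simp }
  have := (SimplyConnectedSpace.paths_homotopic δ δ').map ⟨Subtype.val, continuous_subtype_val⟩
  exact this

variable {U} (hU : ∀ i, IsSimplyConnected (U i))

theorem kap_eq (i : ι) {x y : X} (hx : x ∈ U i) (hy : y ∈ U i) (γ : Path x y)
    (h : ∀ t, γ t ∈ U i) : kap U hU i hx hy = .mk γ :=
  Path.Homotopic.Quotient.eq.2 (homotopic_of_mem (hU i) _ _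
    (fun t => JoinedIn.somePath_mem _ t) h)

theorem kap_trans (i : ι) {x y z : X} (hx : x ∈ U i) (hy : y ∈ U i) (hz : z ∈ U i) :
    (kap U hU i hx hy).trans (kap U hU i hy hz) = kap U hU i hx hz := by
  symm
  unfold kap
  rw [← Path.Homotopic.Quotient.mk_trans]
  refine kap_eq hU i hx hz _ ?_
  intro t
  have : (((hU i).isPathConnected.joinedIn x hx y hy).somePath.trans
    ((hU i).isPathConnected.joinedIn y hy z hz).somePath) t ∈ range
     (((hU i).isPathConnected.joinedIn x hx y hy).somePath.trans
    ((hU i).isPathConnected.joinedIn y hy z hz).somePath) := mem_range_self _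
  rw [Path.trans_range] at this
  rcases this with ⟨s, hs⟩ | ⟨s, hs⟩ <;> rw [← hs] <;> exact JoinedIn.somePath_mem _ s

theorem kap_self (i : ι) {x : X} (hx : x ∈ U i) :
    kap U hU i hx hx = .refl x := by
  rw [← Path.Homotopic.Quotient.mk_refl]
  exact kap_eq hU i hx hx _ (fun t => hx)

theorem kap_congr (i j : ι) {x y : X} (hx : x ∈ U i) (hy : y ∈ U i) (hx' : x ∈ U j) (hy' : y ∈ U j)
    (h : JoinedIn (U i ∩ U j) x y) : kap U hU i hx hy = kap U hU j hx' hy' := by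
  rw [kap_eq hU i hx hy h.somePath (fun t => (h.somePath_mem t).1),
    kap_eq hU j hx' hy' h.somePath (fun t => (h.somePath_mem t).2)]

variable {p : X} (hp : ∀ i, p ∈ U i)

/-- The loop going out through `U i` to `x` and returning through `U j`. -/
def gg (i j : ι) {x : X} (hi : x ∈ U i) (hj : x ∈ U j) : FundamentalGroup X p :=
  FundamentalGroup.fromPath ((kap U hU i (hp i) hi).trans (kap U hU j hj (hp j)))

theorem gg_comp (i j k : ι) {x : X} (hi : x ∈ U i) (hj : x ∈ U j) (hk : x ∈ U k) :
    gg hU hp j k hj hk * gg hU hp i j hi hj = gg hU hp i k hi hk := by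
  unfold gg
  rw [FundamentalGroup.mul_def]
  change ((kap U hU i (hp i) hi).trans (kap U hU j hj (hp j))).trans
    ((kap U hU j (hp j) hj).trans (kap U hU k hk (hp k))) = _
  rw [Path.Homotopic.Quotient.trans_assoc, ← Path.Homotopic.Quotient.trans_assoc (kap U hU j hj (hp j)),
    kap_trans, kap_self, Path.Homotopic.Quotient.refl_trans]

theorem gg_self (i : ι) {x : X} (hi : x ∈ U i) : gg hU hp i i hi hi = 1 := by
  have := gg_comp hU hp i i i hi hi hi
  exact mul_eq_left.1 this

theorem gg_base (i j : ι) : gg hU hp i j (hp i) (hp j) = 1 := by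
  unfold gg
  rw [kap_self, kap_self, Path.Homotopic.Quotient.refl_trans]
  rfl

theorem gg_joined (i j : ι) {x y : X} (hi : x ∈ U i) (hj : x ∈ U j) (hi' : y ∈ U i) (hj' : y ∈ U j)
    (h : JoinedIn (U i ∩ U j) x y) : gg hU hp i j hi hj = gg hU hp i j hi' hj' := by
  unfold gg
  congr 1
  rw [← kap_trans hU i (hp i) hi hi', Path.Homotopic.Quotient.trans_assoc,
    kap_congr hU i j hi hi' hj hj' h, kap_trans]

/-- Subdivision argument: the loops `gg` generate. -/
theorem mem_of_gg_mem (hopen : ∀ i, IsOpen (U i)) (hcov : ∀ x, ∃ i, x ∈ U i)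
    (H : Subgroup (FundamentalGroup X p))
    (hH : ∀ i j x (hi : x ∈ U i) (hj : x ∈ U j), gg hU hp i j hi hj ∈ H) (c : FundamentalGroup X p) :
    c ∈ H := by
  obtain ⟨γ, rfl⟩ := Path.Homotopic.Quotient.mk_surjective c
  obtain ⟨t, t0, tm, ⟨N, hN⟩, ht⟩ := exists_monotone_Icc_subset_open_cover_unitInterval
    (c := fun i => γ ⁻¹' (U i)) (fun i => (hopen i).preimage γ.continuous)
    (fun s _ => by
      obtain ⟨i, hi⟩ := hcov (γ s)
      exact mem_iUnion.2 ⟨i, hi⟩)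
  have key : ∀ k, ∀ i (h : γ (t k) ∈ U i),
      FundamentalGroup.fromPath (((Path.Homotopic.Quotient.mk (γ.subpath 0 (t k))).cast γ.source.symm rfl).trans
        (kap U hU i h (hp i))) ∈ H := by
    intro k
    induction k with
    | zero =>
      intro i h
      have e : ((Path.Homotopic.Quotient.mk (γ.subpath 0 (t 0))).cast γ.source.symm rfl) =
        kap U hU i (hp i) h := by
        rw [← Path.Homotopic.Quotient.mk_cast]
        symm
        apply kap_eq
        intro s
        rw [Path.cast_coe]
        change γ (Icc.convexComb 0 (t 0) s) ∈ U i
        have e0 : Icc.convexComb 0 (t 0) s = t 0 := by rw [t0]; simp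
        rw [e0]
        exact h
      rw [e, kap_trans, kap_self]
      exact H.one_mem
    | succ k ih =>
      intro i h
      obtain ⟨l, hl⟩ := ht k
      have h1 : γ (t k) ∈ U l := hl ⟨le_rfl, tm (Nat.le_succ k)⟩
      have h2 : γ (t (k+1)) ∈ U l := hl ⟨tm (Nat.le_succ k), le_rfl⟩
      have e1 : Path.Homotopic.Quotient.mk (γ.subpath (t k) (t (k+1))) = kap U hU l h1 h2 := by
        symm
        apply kap_eq
        intro s
        have : γ.subpath (t k) (t (k+1)) s ∈ range (γ.subpath (t k) (t (k+1))) := mem_range_self _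
        rw [Path.range_subpath_of_le _ _ _ (tm (Nat.le_succ k))] at this
        obtain ⟨u, hu, hu'⟩ := this
        rw [← hu']
        exact hl hu
      have e2 : (Path.Homotopic.Quotient.mk (γ.subpath 0 (t (k+1)))).cast γ.source.symm rfl =
        ((Path.Homotopic.Quotient.mk (γ.subpath 0 (t k))).cast γ.source.symm rfl).trans
          (kap U hU l h1 h2) := by
        rw [← e1, ← Path.Homotopic.Quotient.mk_cast, ← Path.Homotopic.Quotient.mk_cast,
          ← Path.Homotopic.Quotient.mk_trans, Path.Homotopic.Quotient.eq]
        exact (Path.Homotopic.pathCast ⟨Path.Homotopy.subpathTransSubpath γ 0 (t k) (t (k+1))⟩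
          γ.source.symm rfl).symm
      have e3 : FundamentalGroup.fromPath (((Path.Homotopic.Quotient.mk (γ.subpath 0 (t (k+1)))).cast
          γ.source.symm rfl).trans (kap U hU i h (hp i))) =
          gg hU hp l i h2 h * FundamentalGroup.fromPath
          (((Path.Homotopic.Quotient.mk (γ.subpath 0 (t k))).cast γ.source.symm rfl).trans
            (kap U hU l h1 (hp l))) := by
        rw [FundamentalGroup.mul_def, e2]
        unfold gg
        change _ = Path.Homotopic.Quotient.trans (Path.Homotopic.Quotient.trans _ _)
          (Path.Homotopic.Quotient.trans _ _)
        rw [Path.Homotopic.Quotient.trans_assoc, Path.Homotopic.Quotient.trans_assoc,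
          ← Path.Homotopic.Quotient.trans_assoc (kap U hU l h1 (hp l)), kap_trans]
      rw [e3]
      exact H.mul_mem (hH _ _ _ _ _) (ih l h1)
  obtain ⟨i, hi⟩ := hcov p
  have h1 := hN N le_rfl
  have hi' : γ (t N) ∈ U i := by rw [h1]; simpa using hi
  have := key N i hi'
  convert this using 1
  have e : kap U hU i hi' (hp i) = .mk ((Path.refl p).cast (by rw [h1]; simp) rfl) := by
    apply kap_eq
    intro t
    simpa using hp i
  rw [e, ← Path.Homotopic.Quotient.mk_cast, ← Path.Homotopic.Quotient.mk_trans]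
  refine Path.Homotopic.Quotient.eq.2 ?_
  have e2 : (((γ.subpath 0 (t N)).cast γ.source.symm rfl).trans
    ((Path.refl p).cast (by rw [h1]; simp) rfl)) = γ.trans (Path.refl p) := by
    ext s
    simp only [Path.trans_apply]
    split_ifs
    · rw [Path.cast_coe]
      change γ (Icc.convexComb 0 (t N) _) = _
      rw [h1]
      simp
    · simp
  rw [e2]
  exact ⟨(Path.Homotopy.transRefl γ).symm⟩

end AbsCover

namespace AbsCover
open Topology unitInterval Set Bundle

variable {X : Type} [TopologicalSpace X] {ι : Type} {U : ι → Set X}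
  {G : Type} [Group G]

/-- The locally constant cocycle data. -/
structure Cocyc (U : ι → Set X) (G : Type) [Group G] where
  w : ι → ι → X → G
  hself : ∀ i x, w i i x = 1
  hcomp : ∀ i j k x, x ∈ U i → x ∈ U j → x ∈ U k → w j k x * w i j x = w i k x
  hloc : ∀ i j x, x ∈ U i → x ∈ U j → ∀ᶠ y in 𝓝 x, w i j y = w i j x
  hopen : ∀ i, IsOpen (U i)
  at_ : X → ι
  mem_at : ∀ x, x ∈ U (at_ x)

/-- The principal bundle with discrete fibre `G`. -/
def core (c : Cocyc U G) [TopologicalSpace G] [DiscreteTopology G] : FiberBundleCore ι X G where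
  baseSet := U
  isOpen_baseSet := c.hopen
  indexAt := c.at_
  mem_baseSet_at := c.mem_at
  coordChange i j x g := c.w i j x * g
  coordChange_self i x _ g := by rw [c.hself, one_mul]
  continuousOn_coordChange i j := by
    rintro ⟨x, g⟩ ⟨⟨hi, hj⟩, -⟩
    apply ContinuousAt.continuousWithinAt
    have h1 : ContinuousAt (fun q : X × G => c.w i j x * q.2) (x, g) :=
      (continuous_of_discreteTopology (f := fun g : G => c.w i j x * g)).continuousAt.comp
        continuousAt_snd
    refine h1.congr ?_
    have h2 : ∀ᶠ q : X × G in 𝓝 (x, g), c.w i j q.1 = c.w i j x :=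
      (continuous_fst.tendsto (x, g)).eventually (c.hloc i j x hi hj)
    filter_upwards [h2] with q hq
    rw [hq]
  coordChange_comp i j k x hx g := by
    rw [← mul_assoc, c.hcomp i j k x hx.1.1 hx.1.2 hx.2]

section
variable (c : Cocyc U G) [TopologicalSpace G] [DiscreteTopology G]

/-- Points of the total space in the chart `i`. -/
def pt (i : ι) (x : X) (g : G) : (core c).TotalSpace := ⟨x, c.w i (c.at_ x) x * g⟩

theorem cov : IsCoveringMap (π G (core c).Fiber) :=
  FiberBundle.isCoveringMap

theorem pt_change (i j : ι) {x : X} (hi : x ∈ U i) (hj : x ∈ U j) (g : G) :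
    pt c i x g = pt c j x (c.w i j x * g) := by
  unfold pt
  rw [← mul_assoc, c.hcomp i j _ x hi hj (c.mem_at x)]

theorem pt_inj (i : ι) {x : X} {g h : G} (e : pt c i x g = pt c i x h) : g = h := by
  unfold pt at e
  have := congrArg (fun z : (core c).TotalSpace => (⟨z.1, z.2⟩ : Σ _ : X, G)) e
  simpa using this

theorem monodromy_pt (i : ι) {x y : X} (γ : Path x y) (h : ∀ t, γ t ∈ U i) (g : G) :
    (cov c).monodromy (.mk γ) ⟨pt c i x g, rfl⟩ = ⟨pt c i y g, rfl⟩ := by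
  have hc : Continuous (fun t => pt c i (γ t) g) := by
    have h1 : ContinuousOn ((core c).localTriv i).toOpenPartialHomeomorph.symm
      ((core c).localTriv i).target := OpenPartialHomeomorph.continuousOn_symm _
    have h2 : Continuous (fun t => (γ t, g)) := by fun_prop
    have h3 := h1.comp_continuous h2 (fun t => by
      rw [FiberBundleCore.mem_localTriv_target]
      exact h t)
    exact h3
  let Γ : Path (pt c i x g) (pt c i y g) :=
    { toFun := fun t => pt c i (γ t) g
      continuous_toFun := hc
      source' := by simp
      target' := by simp }
  have := (cov c).monodromy_map (.mk Γ)
  exact this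

end

/-- The abstract comparison theorem. -/
theorem bijective_of_cocyc (c : Cocyc U G) (hU : ∀ i, IsSimplyConnected (U i)) {p : X}
    (hp : ∀ i, p ∈ U i) (hwp : ∀ i j, c.w i j p = 1)
    (Ψ : G →* FundamentalGroup X p)
    (hΨ : ∀ i j x (hi : x ∈ U i) (hj : x ∈ U j), Ψ (c.w i j x) = gg hU hp i j hi hj)
    (hgen : ∀ H : Subgroup G, (∀ i j x, x ∈ U i → x ∈ U j → c.w i j x ∈ H) → ∀ u, u ∈ H) :
    Function.Bijective Ψ := by
  constructor
  · let _ : TopologicalSpace G := ⊥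
    have _ : DiscreteTopology G := ⟨rfl⟩
    let i₀ := c.at_ p
    have hpt : ∀ i j (g : G), pt c i p g = pt c j p g := fun i j g => by
      rw [pt_change c i j (hp i) (hp j), hwp, one_mul]
    have key : ∀ u g : G, (((cov c).monodromyPerm p (Ψ u)) ⟨pt c i₀ p g, rfl⟩) =
        ⟨pt c i₀ p (u * g), rfl⟩ := by
      let H : Subgroup G :=
        { carrier := {u | ∀ g : G, (((cov c).monodromyPerm p (Ψ u)) ⟨pt c i₀ p g, rfl⟩) =
            ⟨pt c i₀ p (u * g), rfl⟩}
          mul_mem' := by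
            intro u v hu hv g
            rw [map_mul, map_mul, Equiv.Perm.mul_apply, hv g, hu, mul_assoc]
          one_mem' := by
            intro g
            rw [map_one, map_one, one_mul]; rfl
          inv_mem' := by
            intro u hu g
            rw [map_inv, map_inv, Equiv.Perm.inv_eq_iff_eq, hu, mul_inv_cancel_left] }
      refine hgen H ?_
      intro i j x hi hj g
      rw [hΨ i j x hi hj, IsCoveringMap.coe_monodromyPerm]
      have : gg hU hp i j hi hj = (kap U hU i (hp i) hi).trans (kap U hU j hj (hp j)) := rfl
      rw [this, IsCoveringMap.monodromy_trans_apply]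
      have e0 : (⟨pt c i₀ p g, rfl⟩ : (π G (core c).Fiber) ⁻¹' {p}) = ⟨pt c i p g, rfl⟩ :=
        Subtype.ext (hpt i₀ i g)
      have e1 : (⟨pt c i x g, rfl⟩ : (π G (core c).Fiber) ⁻¹' {x}) =
          ⟨pt c j x (c.w i j x * g), rfl⟩ := Subtype.ext (pt_change c i j hi hj g)
      have e2 : (⟨pt c j p (c.w i j x * g), rfl⟩ : (π G (core c).Fiber) ⁻¹' {p}) =
          ⟨pt c i₀ p (c.w i j x * g), rfl⟩ := Subtype.ext (hpt j i₀ _)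
      have m1 : (cov c).monodromy (kap U hU i (hp i) hi) ⟨pt c i p g, rfl⟩ = ⟨pt c i x g, rfl⟩ :=
        monodromy_pt c i _ (fun t => JoinedIn.somePath_mem _ t) g
      have m2 : (cov c).monodromy (kap U hU j hj (hp j)) ⟨pt c j x (c.w i j x * g), rfl⟩ =
          ⟨pt c j p (c.w i j x * g), rfl⟩ :=
        monodromy_pt c j _ (fun t => JoinedIn.somePath_mem _ t) _
      exact (congrArg _ ((congrArg _ e0).trans (m1.trans e1))).trans (m2.trans e2)
    rw [injective_iff_map_eq_one]
    intro u hu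
    have h1 := key u 1
    rw [hu, map_one] at h1
    have h2 := congrArg Subtype.val h1
    have h3 := pt_inj c i₀ h2
    simpa using h3.symm
  · intro z
    exact mem_of_gg_mem hU hp c.hopen (fun x => ⟨_, c.mem_at x⟩) Ψ.range
      (fun i j x hi hj => ⟨_, hΨ i j x hi hj⟩) z

end AbsCover

namespace YBList

variable {I : Type} [DecidableEq I] {G : Type} [Group G]

/-- Yang-Baxter data, on the pairs which are comparable in both directions. -/
structure YB (R : I → I → G) (P : I → I → Prop) : Prop where
  inv : ∀ i j, i ≠ j → P i j → P j i → R i j * R j i = 1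
  yb : ∀ i j k, i ≠ j → i ≠ k → j ≠ k → P i j → P j i → P i k → P k i → P j k → P k j →
    R j k * R i k * R i j = R i j * R i k * R j k
  comm : ∀ i j k l, i ≠ j → i ≠ k → i ≠ l → j ≠ k → j ≠ l → k ≠ l → P i j → P j i →
    P k l → P l k → R i j * R k l = R k l * R i j

/-- Move `a` to the right through the list. -/
def cross (R : I → I → G) (a : I) : List I → G
  | [] => 1
  | m :: N => cross R a N * R a m

/-- The element carrying the first ordering to the second. -/
def wl (R : I → I → G) : List I → List I → G
  | [], _ => 1
  | a :: L, M => cross R a (M.takeWhile (fun m => m ≠ a)) * wl R L (M.erase a)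

variable (R : I → I → G) (P : I → I → Prop)

theorem cross_append (a : I) (A B : List I) :
    cross R a (A ++ B) = cross R a B * cross R a A := by
  induction A with
  | nil => simp [cross]
  | cons m A ih => simp [cross, ih, mul_assoc]

theorem wl_split (a : I) (L A B : List I) (h : a ∉ A) :
    wl R (a :: L) (A ++ a :: B) = cross R a A * wl R L (A ++ B) := by
  have h1 : (A ++ a :: B).takeWhile (fun m => m ≠ a) = A := by
    rw [List.takeWhile_append_of_pos]
    · simp
    · intro m hm
      simp only [ne_eq, decide_not, Bool.not_eq_eq_eq_not, Bool.not_true, decide_eq_false_iff_not]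
      rintro rfl
      exact h hm
  have h2 : (A ++ a :: B).erase a = A ++ B := by
    rw [List.erase_append_right _ h]; simp
  rw [wl, h1, h2]

theorem cross_comm (hR : YB R P) (a p q : I) (A : List I) (hpq : p ≠ q) (hap : a ≠ p) (haq : a ≠ q)
    (h1 : P p q) (h2 : P q p)
    (h : ∀ m ∈ A, m ≠ a ∧ m ≠ p ∧ m ≠ q ∧ P m a ∧ P a m) :
    R p q * cross R a A = cross R a A * R p q := by
  induction A with
  | nil => simp [cross]
  | cons m A ih =>
    have ih' := ih (fun m' hm' => h m' (List.mem_cons_of_mem _ hm'))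
    obtain ⟨e1, e2, e3, e4, e5⟩ := h m List.mem_cons_self
    have := hR.comm p q a m hpq hap.symm e2.symm haq.symm e3.symm e1.symm h1 h2 e5 e4
    rw [cross, ← mul_assoc, ih', mul_assoc, this, mul_assoc]

theorem wl_adj (hR : YB R P) (L : List I) : ∀ (M₁ M₂ : List I) (p q : I),
    L.Pairwise P → (M₁ ++ p :: q :: M₂).Pairwise P → (M₁ ++ q :: p :: M₂).Pairwise P →
    (M₁ ++ p :: q :: M₂).Nodup → L.Perm (M₁ ++ p :: q :: M₂) →
    R p q * wl R L (M₁ ++ p :: q :: M₂) = wl R L (M₁ ++ q :: p :: M₂) := by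
  induction L with
  | nil => intro M₁ M₂ p q _ _ _ _ h; simp at h
  | cons a L ih =>
    intro M₁ M₂ p q hL hM hM' hnd hperm
    have hPpq : P p q ∧ P q p := by
      simp only [List.pairwise_append, List.pairwise_cons, List.mem_cons] at hM hM'
      exact ⟨hM.2.1.1 q (Or.inl rfl), hM'.2.1.1 p (Or.inl rfl)⟩
    have hpq : p ≠ q := by
      rintro rfl
      simp [List.nodup_append] at hnd
    have hPa : ∀ m, m ∈ M₁ ++ p :: q :: M₂ → m ≠ a → P a m := by
      intro m hm hma
      have : m ∈ a :: L := hperm.mem_iff.2 hm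
      exact (List.pairwise_cons.1 hL).1 m (List.mem_of_ne_of_mem hma this)
    have hL' := (List.pairwise_cons.1 hL).2
    by_cases hap : a = p
    · subst hap
      have hn : a ∉ M₁ := by
        intro h
        simp only [List.nodup_append, List.mem_cons] at hnd
        exact hnd.2.2 a h a (Or.inl rfl) rfl
      have e : M₁ ++ q :: a :: M₂ = (M₁ ++ [q]) ++ a :: M₂ := by simp
      rw [wl_split R a L M₁ _ hn, e, wl_split R a L _ _ (by simp [hn, hpq]), cross_append]
      simp [cross, mul_assoc]
    by_cases haq : a = q
    · subst haq
      have hn : a ∉ M₁ := by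
        intro h
        simp only [List.nodup_append, List.mem_cons] at hnd
        exact hnd.2.2 a h a (Or.inr (Or.inl rfl)) rfl
      have e : M₁ ++ p :: a :: M₂ = (M₁ ++ [p]) ++ a :: M₂ := by simp
      rw [wl_split R a L M₁ _ hn, e, wl_split R a L _ _ (by simp [hn, hap]), cross_append]
      simp only [cross, one_mul, List.append_assoc, List.cons_append, List.nil_append]
      rw [← mul_assoc, ← mul_assoc, hR.inv p a hpq hPpq.1 hPpq.2, one_mul]
    have hmem : a ∈ M₁ ∨ a ∈ M₂ := by
      have : a ∈ M₁ ++ p :: q :: M₂ := hperm.mem_iff.1 List.mem_cons_self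
      simpa [hap, haq] using this
    rcases hmem with hmem | hmem
    · obtain ⟨A, B, rfl⟩ := List.append_of_mem hmem
      have ha : a ∉ A := by
        simp only [List.nodup_append, List.mem_cons, List.append_assoc, List.cons_append] at hnd
        intro h
        exact hnd.2.2 a h a (by simp) rfl
      have e1 : ∀ N : List I, A ++ a :: B ++ N = A ++ a :: (B ++ N) := by intro N; simp
      rw [e1, e1, wl_split R a L _ _ ha, wl_split R a L _ _ ha]
      have hperm' : L.Perm ((A ++ B) ++ p :: q :: M₂) := by
        have h3 := hperm.trans (show (A ++ a :: B ++ p :: q :: M₂).Perm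
          (a :: ((A ++ B) ++ p :: q :: M₂)) by
            simp [List.perm_middle])
        exact (List.perm_cons a).1 h3
      have sub : ∀ N : List I, ((A ++ B) ++ N).Sublist (A ++ a :: B ++ N) := by
        intro N
        simp
      have ih' := ih (A ++ B) M₂ p q hL' (hM.sublist (sub _)) (hM'.sublist (sub _))
        (hnd.sublist (sub _)) hperm'
      rw [List.append_assoc, List.append_assoc] at ih'
      rw [← ih', ← mul_assoc, ← mul_assoc]
      congr 1
      apply cross_comm R P hR a p q A hpq hap haq hPpq.1 hPpq.2
      intro m hm
      have hma : m ≠ a := by rintro rfl; exact ha hm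
      simp only [List.nodup_append, List.append_assoc, List.cons_append] at hnd
      refine ⟨hma, ?_, ?_, ?_, hPa m (by simp [hm]) hma⟩
      · exact hnd.2.2 m hm p (by simp)
      · exact hnd.2.2 m hm q (by simp)
      · simp only [List.pairwise_append, List.append_assoc, List.cons_append] at hM
        exact hM.2.2 m hm a (by simp)
    · obtain ⟨A, B, rfl⟩ := List.append_of_mem hmem
      have hnd0 := hnd
      simp only [List.nodup_append, List.nodup_cons, List.mem_cons, List.mem_append] at hnd
      have hM0 := hM
      have hM0' := hM'
      simp only [List.pairwise_append, List.pairwise_cons, List.mem_cons, List.mem_append] at hM hM'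
      have ha : a ∉ M₁ ++ p :: q :: A := by
        simp only [List.mem_append, List.mem_cons, not_or]
        refine ⟨fun h => hnd.2.2 a h a (by simp) rfl, hap, haq, fun h => ?_⟩
        exact hnd.2.1.2.2.2.2 a h a (by simp) rfl
      have ha' : a ∉ M₁ ++ q :: p :: A := by
        simp only [List.mem_append, List.mem_cons, not_or] at ha ⊢
        tauto
      have e1 : ∀ r s, M₁ ++ r :: s :: (A ++ a :: B) = (M₁ ++ r :: s :: A) ++ a :: B := by
        intro r s; simp
      rw [e1, e1, wl_split R a L _ _ ha, wl_split R a L _ _ ha']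
      have hperm' : L.Perm (M₁ ++ p :: q :: (A ++ B)) := by
        have h3 := hperm.trans (show (M₁ ++ p :: q :: (A ++ a :: B)).Perm
          (a :: (M₁ ++ p :: q :: (A ++ B))) by
            rw [e1]
            refine List.perm_middle.trans ?_
            simp)
        exact (List.perm_cons a).1 h3
      have sub : ∀ r s, (M₁ ++ r :: s :: (A ++ B)).Sublist (M₁ ++ r :: s :: (A ++ a :: B)) := by
        intro r s
        simp
      have ih' := ih M₁ (A ++ B) p q hL' (hM0.sublist (sub _ _)) (hM0'.sublist (sub _ _))
        (hnd0.sublist (sub _ _)) hperm'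
      have e2 : ∀ r s, (M₁ ++ r :: s :: A) ++ B = M₁ ++ r :: s :: (A ++ B) := by
        intro r s; simp
      rw [e2, e2, ← ih', cross_append, cross_append, cross, cross, cross, cross]
      have c1 : R p q * cross R a A = cross R a A * R p q := by
        apply cross_comm R P hR a p q A hpq hap haq hPpq.1 hPpq.2
        intro m hm
        have hma : m ≠ a := by rintro rfl; exact ha (by simp [hm])
        refine ⟨hma, ?_, ?_, hM.2.1.2.2.2.2 m hm a (by simp), hPa m (by simp [hm]) hma⟩
        · rintro rfl; exact hnd.2.1.1 (by simp [hm])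
        · rintro rfl; exact hnd.2.1.2.1 (by simp [hm])
      have c2 : R p q * cross R a M₁ = cross R a M₁ * R p q := by
        apply cross_comm R P hR a p q M₁ hpq hap haq hPpq.1 hPpq.2
        intro m hm
        have hma : m ≠ a := by rintro rfl; exact ha (by simp [hm])
        exact ⟨hma, hnd.2.2 m hm p (by simp), hnd.2.2 m hm q (by simp),
          hM.2.2 m hm a (by simp), hPa m (by simp [hm]) hma⟩
      have y := hR.yb a p q hap haq hpq (hPa p (by simp) (Ne.symm hap))
        (hM.2.1.1 a (by simp)) (hPa q (by simp) (Ne.symm haq)) (hM.2.1.2.1 a (by simp))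
        hPpq.1 hPpq.2
      simp only [← mul_assoc]
      rw [c1]
      congr 1
      simp only [mul_assoc]
      congr 1
      simp only [← mul_assoc]
      rw [y]
      simp only [mul_assoc]
      rw [c2]

/-- Admissible orderings. -/
def SS (L₀ L : List I) : Prop := L.Pairwise P ∧ L.Nodup ∧ L.Perm L₀

section uniq
variable {R P} {L₀ : List I} (g : List I → List I → G)

theorem move_eq
    (gself : ∀ L, SS P L₀ L → g L L = 1)
    (gcomp : ∀ L M N, SS P L₀ L → SS P L₀ M → SS P L₀ N → g M N * g L M = g L N)
    (gadj : ∀ K i j N, SS P L₀ (K ++ i :: j :: N) → SS P L₀ (K ++ j :: i :: N) →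
      g (K ++ i :: j :: N) (K ++ j :: i :: N) = R i j)
    (p : I) (N₁ N₂ : List I) : ∀ K, SS P L₀ (K ++ p :: (N₁ ++ N₂)) →
    SS P L₀ (K ++ (N₁ ++ p :: N₂)) →
    g (K ++ p :: (N₁ ++ N₂)) (K ++ (N₁ ++ p :: N₂)) = cross R p N₁ := by
  induction N₁ with
  | nil => intro K h1 _; simpa [cross] using gself _ h1
  | cons m N₁ ih =>
    intro K h1 h2
    have h3 : SS P L₀ (K ++ m :: p :: (N₁ ++ N₂)) := by
      have hp : (K ++ m :: p :: (N₁ ++ N₂)).Perm (K ++ p :: (m :: N₁ ++ N₂)) :=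
        List.Perm.append_left _ (List.Perm.swap _ _ _)
      refine ⟨?_, hp.nodup_iff.2 h1.2.1, hp.trans h1.2.2⟩
      have a1 := h1.1
      have a2 := h2.1
      simp only [List.pairwise_append, List.pairwise_cons, List.mem_cons, List.mem_append,
        List.cons_append] at a1 a2 ⊢
      grind
    have e1 := gadj K p m (N₁ ++ N₂) h1 h3
    have e2 := ih (K ++ [m]) (by simpa using h3) (by simpa using h2)
    rw [cross, ← e1, ← e2, ← gcomp _ _ _ h1 h3 h2]
    simp

theorem eq_wl
    (gself : ∀ L, SS P L₀ L → g L L = 1)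
    (gcomp : ∀ L M N, SS P L₀ L → SS P L₀ M → SS P L₀ N → g M N * g L M = g L N)
    (gadj : ∀ K i j N, SS P L₀ (K ++ i :: j :: N) → SS P L₀ (K ++ j :: i :: N) →
      g (K ++ i :: j :: N) (K ++ j :: i :: N) = R i j)
    (M : List I) : ∀ K N, SS P L₀ (K ++ M) → SS P L₀ (K ++ N) → M.Perm N →
    g (K ++ M) (K ++ N) = wl R M N := by
  induction M with
  | nil =>
    intro K N h1 h2 h3
    have : N = [] := by simpa using h3.symm
    subst this
    rw [wl]
    exact gself _ h1
  | cons p M ih =>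
    intro K N h1 h2 h3
    have hp : p ∈ N := h3.mem_iff.1 List.mem_cons_self
    obtain ⟨A, B, rfl⟩ := List.append_of_mem hp
    have hpA : p ∉ A := by
      have := h2.2.1
      simp only [List.nodup_append, List.mem_append, List.mem_cons] at this
      intro h
      exact this.2.1.2.2 p h p (by simp) rfl
    have h4 : M.Perm (A ++ B) := (List.perm_cons p).1 (h3.trans List.perm_middle)
    have h5 : SS P L₀ (K ++ p :: (A ++ B)) := by
      have hq : (K ++ p :: (A ++ B)).Perm (K ++ p :: M) := by
        refine List.Perm.append_left _ (List.Perm.cons _ h4.symm)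
      refine ⟨?_, hq.nodup_iff.2 h1.2.1, hq.trans h1.2.2⟩
      have a1 := h1.1
      have a2 := h2.1
      have h6 : ∀ x, x ∈ M ↔ x ∈ A ∨ x ∈ B := fun x => by rw [h4.mem_iff]; simp
      simp only [List.pairwise_append, List.pairwise_cons, List.mem_cons, List.mem_append,
        List.cons_append] at a1 a2 ⊢
      clear * - a1 a2 h6
      exact ⟨a1.1, ⟨fun a h => a1.2.1.1 a ((h6 a).2 h), a2.2.1.1, a2.2.1.2.1.2, fun a ha b hb => a2.2.1.2.2 a ha b (Or.inr hb)⟩, fun a ha b hb => hb.elim (fun hb => a1.2.2 a ha b (Or.inl hb)) (fun hb => a1.2.2 a ha b (Or.inr ((h6 b).2 hb)))⟩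
    rw [wl_split R p M A B hpA, ← gcomp _ _ _ h1 h5 h2]
    congr 1
    · exact move_eq g gself gcomp gadj p A B K h5 h2
    · have := ih (K ++ [p]) (A ++ B) (by simpa using h1) (by simpa using h5) h4
      simpa using this
end uniq

theorem wl_self (L : List I) : wl R L L = 1 := by
  induction L with
  | nil => rfl
  | cons a L ih =>
    have := wl_split R a L [] L (by simp)
    simpa [cross, ih] using this

theorem wl_comp (hR : YB R P) {L₀ : List I} (L M N : List I) (hL : SS P L₀ L) (hM : SS P L₀ M)
    (hN : SS P L₀ N) : wl R M N * wl R L M = wl R L N := by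
  have := eq_wl (R := R) (P := P) (L₀ := L₀) (fun M N => wl R L N * (wl R L M)⁻¹)
    (fun _ _ => by simp) (fun _ _ _ _ _ _ => by simp [mul_assoc])
    (fun K i j N h1 h2 => by
      have := wl_adj R P hR L K N i j hL.1 h1.1 h2.1 h1.2.1 (hL.2.2.trans h1.2.2.symm)
      rw [← this]; simp)
    M [] N hM hN (hM.2.2.trans hN.2.2.symm)
  simp only [List.nil_append] at this
  rw [← this]; simp

theorem wl_adj_eq (p q : I) (K N : List I) (h : (K ++ p :: q :: N).Nodup) :
    wl R (K ++ p :: q :: N) (K ++ q :: p :: N) = R p q := by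
  induction K with
  | nil =>
    have hq : p ≠ q := by rintro rfl; simp at h
    have := wl_split R p (q :: N) [q] N (by simpa using hq)
    simpa [cross, wl_self] using this
  | cons a K ih =>
    have := wl_split R a (K ++ p :: q :: N) [] (K ++ q :: p :: N) (by simp)
    simp only [List.nil_append, cross, one_mul] at this
    rw [List.cons_append, List.cons_append, this]
    exact ih (by simpa using (List.nodup_cons.1 h).2)

/-- Locality: `wl` only depends on the values of `R` on inverted pairs. -/
theorem wl_congr (R' : I → I → G) (L : List I) : ∀ M, L.Pairwise P → M.Pairwise P → M.Nodup →
    L.Perm M → (∀ i j, i ≠ j → P i j → P j i → R i j = R' i j) → wl R L M = wl R' L M := by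
  induction L with
  | nil => intros; rfl
  | cons a L ih =>
    intro M hL hM hnd hp h
    obtain ⟨A, B, rfl⟩ := List.append_of_mem (hp.mem_iff.1 List.mem_cons_self)
    have ha : a ∉ A := by
      simp only [List.nodup_append, List.mem_cons] at hnd
      intro h
      exact hnd.2.2 a h a (by simp) rfl
    have sub : (A ++ B).Sublist (A ++ a :: B) := by simp
    have hp' : L.Perm (A ++ B) := (List.perm_cons a).1 (hp.trans List.perm_middle)
    rw [wl_split R a L A B ha, wl_split R' a L A B ha, ih (A ++ B) (List.pairwise_cons.1 hL).2
      (hM.sublist sub) (hnd.sublist sub) hp' h]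
    congr 1
    have : ∀ m ∈ A, R a m = R' a m := by
      intro m hm
      have hma : m ≠ a := by rintro rfl; exact ha hm
      apply h a m hma.symm
      · exact (List.pairwise_cons.1 hL).1 m (hp'.mem_iff.2 (by simp [hm]))
      · simp only [List.pairwise_append] at hM
        exact hM.2.2 m hm a (by simp)
    clear * - this
    induction A with
    | nil => rfl
    | cons m A ih =>
      rw [cross, cross, ih (fun m hm => this m (by simp [hm])), this m (by simp)]

theorem wl_one (L : List I) : ∀ M, wl (fun _ _ => (1 : G)) L M = 1 := by
  have hc : ∀ (a : I) (A : List I), cross (fun _ _ => (1 : G)) a A = 1 := by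
    intro a A
    induction A with
    | nil => rfl
    | cons m A ih => simp [cross, ih]
  induction L with
  | nil => intro M; rfl
  | cons a L ih => intro M; rw [wl, hc, ih, one_mul]

theorem map_wl {H : Type} [Group H] (f : G →* H) (L : List I) : ∀ M,
    f (wl R L M) = wl (fun i j => f (R i j)) L M := by
  have hc : ∀ (a : I) (A : List I), f (cross R a A) = cross (fun i j => f (R i j)) a A := by
    intro a A
    induction A with
    | nil => simp [cross]
    | cons m A ih => simp [cross, ih]
  induction L with
  | nil => intro M; simp [wl]
  | cons a L ih => intro M; rw [wl, wl, map_mul, hc, ih]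

end YBList

namespace RingModel
open Topology unitInterval Set YBList AbsCover

/-- The ambient space: heights, and planar circles (center, radius). -/
abbrev Amb (n : ℕ) : Type := (Fin n → ℝ) × (Fin n → ℂ × ℝ)

/-- Disjoint disks. -/
def Apart (u v : ℂ × ℝ) : Prop := u.2 + v.2 < ‖u.1 - v.1‖
/-- `u` is nested inside `v`. -/
def Nst (u v : ℂ × ℝ) : Prop := ‖u.1 - v.1‖ + u.2 < v.2
/-- Disjoint planar circles. -/
def Dj (u v : ℂ × ℝ) : Prop := Apart u v ∨ Nst u v ∨ Nst v u

theorem Apart.symm {u v : ℂ × ℝ} (h : Apart u v) : Apart v u := by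
  unfold Apart at *; rw [norm_sub_rev]; linarith

theorem Dj.symm {u v : ℂ × ℝ} (h : Dj u v) : Dj v u := by
  rcases h with h | h | h
  · exact Or.inl h.symm
  · exact Or.inr (Or.inr h)
  · exact Or.inr (Or.inl h)

theorem Nst.asymm {u v : ℂ × ℝ} (h : Nst u v) : ¬ Nst v u := by
  unfold Nst at *
  intro h'
  have := norm_nonneg (u.1 - v.1)
  have := norm_nonneg (v.1 - u.1)
  linarith

theorem Apart.not_nst {u v : ℂ × ℝ} (h : Apart u v) (hu : 0 < u.2) : ¬ Nst u v := by
  unfold Nst Apart at *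
  intro h'
  linarith

theorem Nst.trans {u v w : ℂ × ℝ} (h : Nst u v) (h' : Nst v w) : Nst u w := by
  unfold Nst at *
  have := norm_sub_le_norm_sub_add_norm_sub u.1 v.1 w.1
  linarith

theorem Nst.not_apart {u v w : ℂ × ℝ} (h : Nst u v) (h' : Nst u w) (hu : 0 < u.2) :
    ¬ Apart v w := by
  unfold Nst Apart at *
  have := norm_sub_le_norm_sub_add_norm_sub v.1 u.1 w.1
  rw [norm_sub_rev v.1 u.1] at this
  intro h2
  linarith

variable {n : ℕ}

/-- The configuration condition. -/
def IsC (q : Amb n) : Prop :=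
  (∀ i, 0 < (q.2 i).2) ∧ ∀ i j, i ≠ j → q.1 i ≠ q.1 j ∨ Dj (q.2 i) (q.2 j)

variable (n) in
/-- The model configuration space. -/
abbrev Conf : Type := {q : Amb n // IsC q}

/-- `i` may be put before `j`. -/
def PP (q : Amb n) (i j : Fin n) : Prop := q.1 i < q.1 j ∨ Dj (q.2 i) (q.2 j)

theorem PP.dj {q : Amb n} {i j : Fin n} (h : PP q i j) (h' : PP q j i) : Dj (q.2 i) (q.2 j) := by
  rcases h with h | h
  · rcases h' with h' | h'
    · exact absurd h h'.asymm
    · exact h'.symm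
  · exact h

/-- Points compatible with a relation. -/
def TT (Q : Fin n → Fin n → Prop) : Set (Amb n) :=
  {q | (∀ i, 0 < (q.2 i).2) ∧ ∀ i j, Q i j → PP q i j}

/-- Order of a list. -/
def QL (L : List (Fin n)) (i j : Fin n) : Prop := L.idxOf i < L.idxOf j

/-- A complete list. -/
def Ok (L : List (Fin n)) : Prop := L.Nodup ∧ L.Perm (List.finRange n)

theorem Ok.mem {L : List (Fin n)} (h : Ok L) (i : Fin n) : i ∈ L :=
  h.2.mem_iff.2 (List.mem_finRange i)

theorem Ok.inj {L : List (Fin n)} (h : Ok L) {i j : Fin n} (e : L.idxOf i = L.idxOf j) : i = j :=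
  (List.idxOf_inj (h.mem i)).1 e

theorem Ok.total {L : List (Fin n)} (h : Ok L) {i j : Fin n} (e : i ≠ j) : QL L i j ∨ QL L j i :=
  lt_or_gt_of_ne fun h' => e (h.inj h')

theorem Ok.pairwise_iff {L : List (Fin n)} (h : Ok L) (P : Fin n → Fin n → Prop) :
    L.Pairwise P ↔ ∀ i j, QL L i j → P i j := by
  rw [List.pairwise_iff_getElem]
  constructor
  · intro H i j hij
    have := H (L.idxOf i) (L.idxOf j) (List.idxOf_lt_length_of_mem (h.mem i))
      (List.idxOf_lt_length_of_mem (h.mem j)) hij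
    simpa using this
  · intro H i j hi hj hij
    apply H
    unfold QL
    rw [List.Nodup.idxOf_getElem h.1, List.Nodup.idxOf_getElem h.1]
    exact hij

/-- Points compatible with a list. -/
def SL (L : List (Fin n)) : Set (Amb n) := TT (QL L)

theorem SL.isC {L : List (Fin n)} (h : Ok L) {q : Amb n} (hq : q ∈ SL L) : IsC q := by
  refine ⟨hq.1, fun i j hij => ?_⟩
  rcases h.total hij with h' | h'
  · exact (hq.2 i j h').imp (fun h => h.ne) id
  · exact (hq.2 j i h').imp (fun h => h.ne') Dj.symm

theorem SL_inter (L M : List (Fin n)) : SL L ∩ SL M = TT (fun i j => QL L i j ∨ QL M i j) := by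
  ext q
  simp only [SL, TT, mem_inter_iff, mem_ofPred_eq]
  constructor
  · rintro ⟨h1, h2⟩
    exact ⟨h1.1, fun i j h => h.elim (h1.2 i j) (h2.2 i j)⟩
  · rintro ⟨h1, h2⟩
    exact ⟨⟨h1, fun i j h => h2 i j (Or.inl h)⟩, ⟨h1, fun i j h => h2 i j (Or.inr h)⟩⟩

variable (n) in
/-- Index type of the cover. -/
abbrev Ix : Type := {L : List (Fin n) // Ok L}

variable (n) in
/-- The cover. -/
def UU (L : Ix n) : Set (Conf n) := {x | x.1 ∈ SL L.1}

/-- segments in the `a` direction -/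
theorem joined_a {Q : Fin n → Fin n → Prop} {a a' : Fin n → ℝ} {b : Fin n → ℂ × ℝ}
    (h : (a, b) ∈ TT Q) (h' : (a', b) ∈ TT Q) (t : ℝ) (ht0 : 0 ≤ t) (ht1 : t ≤ 1) :
    ((fun i => (1 - t) * a i + t * a' i, b) : Amb n) ∈ TT Q := by
  refine ⟨h.1, fun i j hij => ?_⟩
  rcases h.2 i j hij with h1 | h1
  · rcases h'.2 i j hij with h2 | h2
    · left
      simp only at h1 h2 ⊢
      rcases eq_or_lt_of_le ht0 with rfl | h0
      · linarith
      · nlinarith [mul_lt_mul_of_pos_left h2 h0, mul_le_mul_of_nonneg_left h1.le (sub_nonneg.2 ht1)]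
    · exact Or.inr h2
  · exact Or.inr h1

theorem joinedIn_of_fun {X : Type} [TopologicalSpace X] {S : Set X} {x y : X} (f : ℝ → X)
    (hf : Continuous f) (h0 : f 0 = x) (h1 : f 1 = y) (h : ∀ t, 0 ≤ t → t ≤ 1 → f t ∈ S) :
    JoinedIn S x y :=
  ⟨⟨⟨fun t : I => f t, hf.comp continuous_subtype_val⟩, by simpa using h0, by simpa using h1⟩,
    fun t => h t t.2.1 t.2.2⟩

theorem joinedIn_a {Q : Fin n → Fin n → Prop} {a a' : Fin n → ℝ} {b : Fin n → ℂ × ℝ}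
    (h : (a, b) ∈ TT Q) (h' : (a', b) ∈ TT Q) : JoinedIn (TT Q) (a, b) (a', b) := by
  refine joinedIn_of_fun (fun t => ((fun i => (1 - t) * a i + t * a' i, b) : Amb n)) ?_ ?_ ?_
    (joined_a h h')
  · fun_prop
  · simp
  · simp

theorem joinedIn_b {Q : Fin n → Fin n → Prop} {a : Fin n → ℝ} {b b' : Fin n → ℂ × ℝ}
    {S : Set (Fin n → ℂ × ℝ)} (h : JoinedIn S b b') (hS : ∀ c ∈ S, (a, c) ∈ TT Q) :
    JoinedIn (TT Q) (a, b) (a, b') := by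
  obtain ⟨γ, hγ⟩ := h
  refine ⟨⟨⟨fun t => (a, γ t), by fun_prop⟩, by simp, by simp⟩, fun t => hS _ (hγ t)⟩

/-- Lifting to the configuration space. -/
theorem joinedIn_lift (L M : Ix n) {x y : Conf n} (h : JoinedIn (SL L.1 ∩ SL M.1) x.1 y.1) :
    JoinedIn (UU n L ∩ UU n M) x y := by
  obtain ⟨γ, hγ⟩ := h
  refine ⟨⟨⟨fun t => ⟨γ t, SL.isC L.2 (hγ t).1⟩, by fun_prop⟩, ?_, ?_⟩, fun t => hγ t⟩
  · apply Subtype.ext; simp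
  · apply Subtype.ext; simp

theorem joinedIn_lift1 (L : Ix n) {x y : Conf n} (h : JoinedIn (SL L.1) x.1 y.1) :
    JoinedIn (UU n L) x y := by
  obtain ⟨γ, hγ⟩ := h
  refine ⟨⟨⟨fun t => ⟨γ t, SL.isC L.2 (hγ t)⟩, by fun_prop⟩, ?_, ?_⟩, fun t => hγ t⟩
  · apply Subtype.ext; simp
  · apply Subtype.ext; simp

/-- scale for the base configuration -/
def sc (n : ℕ) : ℝ := 10 * (1 + 2 * n)

/-- centers in convex position -/
def zz (k : Fin n) : ℂ := ⟨sc n * (k : ℕ), sc n * ((k : ℕ) : ℝ) ^ 2⟩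

theorem zz_dist (i j l : Fin n) (hi : i ≠ l) (hj : j ≠ l) (t : ℝ) (h0 : 0 ≤ t) (h1 : t ≤ 1) :
    10 ≤ ‖((1 - t : ℝ) : ℂ) * zz i + (t : ℂ) * zz j - zz l‖ := by
  set d := ((1 - t : ℝ) : ℂ) * zz i + (t : ℂ) * zz j - zz l with hd
  have key : ∀ m : Fin n, m ≠ l → (1 : ℝ) ≤ (((m : ℕ) : ℝ) - ((l : ℕ) : ℝ)) ^ 2 := by
    intro m hm
    have : ((m : ℕ) : ℤ) - ((l : ℕ) : ℤ) ≠ 0 := by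
      intro h; apply hm; apply Fin.ext; omega
    have h2 : (1 : ℤ) ≤ (((m : ℕ) : ℤ) - ((l : ℕ) : ℤ)) ^ 2 := by
      have : 0 < (((m : ℕ) : ℤ) - ((l : ℕ) : ℤ)) ^ 2 := by positivity
      omega
    exact_mod_cast h2
  have ki := key i hi
  have kj := key j hj
  have hs : (0 : ℝ) < sc n := by unfold sc; positivity
  have e : d.im - 2 * (l : ℕ) * d.re = sc n * ((1 - t) * ((((i : ℕ) : ℝ) - ((l : ℕ) : ℝ)) ^ 2)
      + t * ((((j : ℕ) : ℝ) - ((l : ℕ) : ℝ)) ^ 2)) := by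
    simp only [hd, zz, Complex.sub_im, Complex.add_im, Complex.mul_im, Complex.ofReal_re,
      Complex.ofReal_im, Complex.sub_re, Complex.add_re, Complex.mul_re]
    ring
  have e2 : sc n ≤ d.im - 2 * (l : ℕ) * d.re := by
    rw [e]
    have : 1 ≤ ((1 - t) * ((((i : ℕ) : ℝ) - ((l : ℕ) : ℝ)) ^ 2)
      + t * ((((j : ℕ) : ℝ) - ((l : ℕ) : ℝ)) ^ 2)) := by nlinarith
    nlinarith
  have a1 := Complex.abs_im_le_norm d
  have a2 := Complex.abs_re_le_norm d
  have a3 := le_abs_self d.im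
  have a4 := neg_abs_le d.re
  have hl : ((l : ℕ) : ℝ) ≤ n := by exact_mod_cast l.2.le
  have hl0 : (0 : ℝ) ≤ ((l : ℕ) : ℝ) := by positivity
  have hn := norm_nonneg d
  have e3 : sc n ≤ (1 + 2 * n) * ‖d‖ := by nlinarith
  unfold sc at e3
  have : (0 : ℝ) < 1 + 2 * n := by positivity
  nlinarith

/-- deformed base configuration: `i` moves into `j`. -/
def bt (i j : Fin n) (t : ℝ) (k : Fin n) : ℂ × ℝ :=
  (if k = i then ((1 - t : ℝ) : ℂ) * zz i + (t : ℂ) * zz j else zz k, if k = j then 1 + 2 * t else 1)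

/-- base circles -/
def b0 (k : Fin n) : ℂ × ℝ := (zz k, 1)

theorem bt_zero (i j : Fin n) : bt i j 0 = b0 := by
  funext k
  simp only [bt, b0]
  split_ifs <;> simp_all

theorem bt_pos (i j : Fin n) (t : ℝ) (h0 : 0 ≤ t) (k : Fin n) : 0 < (bt i j t k).2 := by
  simp only [bt]; split_ifs <;> linarith

theorem bt_apart (i j : Fin n) (t : ℝ) (h0 : 0 ≤ t) (h1 : t ≤ 1) (k l : Fin n) (hkl : k ≠ l)
    (h : ¬ (k = i ∧ l = j)) (h' : ¬ (k = j ∧ l = i)) : Apart (bt i j t k) (bt i j t l) := by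
  have hr : ∀ m, (bt i j t m).2 ≤ 3 := by intro m; simp only [bt]; split_ifs <;> linarith
  suffices 10 ≤ ‖(bt i j t k).1 - (bt i j t l).1‖ by
    unfold Apart; linarith [hr k, hr l]
  simp only [bt]
  by_cases hk : k = i
  · subst hk
    have hl : l ≠ k := Ne.symm hkl
    have hj : j ≠ l := fun e => h ⟨rfl, e.symm⟩
    simpa [hl] using zz_dist k j l hkl hj t h0 h1
  · by_cases hl : l = i
    · subst hl
      rw [norm_sub_rev]
      have hj : j ≠ k := fun e => h' ⟨e.symm, rfl⟩
      simpa [hk] using zz_dist l j k hkl.symm hj t h0 h1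
    · simpa [hk, hl] using zz_dist k k l hkl hkl 0 le_rfl zero_le_one

theorem bt_nst (i j : Fin n) (hij : i ≠ j) : Nst (bt i j 1 i) (bt i j 1 j) := by
  unfold Nst
  simp [bt, hij, hij.symm]

theorem bt_dj (i j : Fin n) (hij : i ≠ j) (k l : Fin n) (hkl : k ≠ l) :
    Dj (bt i j 1 k) (bt i j 1 l) := by
  by_cases h : k = i ∧ l = j
  · obtain ⟨rfl, rfl⟩ := h
    exact Or.inr (Or.inl (bt_nst _ _ hij))
  by_cases h' : k = j ∧ l = i
  · obtain ⟨rfl, rfl⟩ := h'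
    exact Or.inr (Or.inr (bt_nst _ _ hij))
  exact Or.inl (bt_apart i j 1 zero_le_one le_rfl k l hkl h h')

theorem b0_apart (k l : Fin n) (hkl : k ≠ l) : Apart (b0 k) (b0 l) := by
  have := zz_dist k k l hkl hkl 0 le_rfl zero_le_one
  unfold Apart b0
  simp at this ⊢
  linarith

theorem mem_SL_of_dj {L : List (Fin n)} (a : Fin n → ℝ) (b : Fin n → ℂ × ℝ)
    (hb : ∀ i, 0 < (b i).2) (hd : ∀ k l, k ≠ l → Dj (b k) (b l)) : (a, b) ∈ SL L :=
  ⟨hb, fun i j hij => Or.inr (hd i j (by rintro rfl; exact lt_irrefl _ hij))⟩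

theorem b0_mem (L : List (Fin n)) (a : Fin n → ℝ) : (a, b0) ∈ SL L :=
  mem_SL_of_dj a b0 (fun _ => by simp [b0]) fun k l h => Or.inl (b0_apart k l h)

theorem bt_mem (L : List (Fin n)) (a : Fin n → ℝ) (i j : Fin n) (hij : i ≠ j) :
    (a, bt i j 1) ∈ SL L :=
  mem_SL_of_dj a _ (bt_pos i j 1 zero_le_one) (bt_dj i j hij)

/-- heights given by a list -/
def aL (L : List (Fin n)) (k : Fin n) : ℝ := L.idxOf k

theorem aL_mem (L : List (Fin n)) (b : Fin n → ℂ × ℝ) (hb : ∀ i, 0 < (b i).2) : (aL L, b) ∈ SL L :=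
  ⟨hb, fun i j hij => Or.inl (by simpa [aL, QL] using hij)⟩

theorem lin_pos {x y t : ℝ} (hx : 0 < x) (hy : 0 < y) (h0 : 0 ≤ t) (h1 : t ≤ 1) :
    0 < (1 - t) * x + t * y := by
  rcases eq_or_lt_of_le h0 with rfl | h
  · simpa using hx
  · nlinarith [mul_pos h hy, mul_nonneg (sub_nonneg.2 h1) hx.le]

/-- linear interpolation of circles -/
def lb (b b' : Fin n → ℂ × ℝ) (t : ℝ) (k : Fin n) : ℂ × ℝ := (1 - t) • b k + t • b' k

theorem lb_pos (b b' : Fin n → ℂ × ℝ) (hb : ∀ i, 0 < (b i).2) (hb' : ∀ i, 0 < (b' i).2) (t : ℝ)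
    (h0 : 0 ≤ t) (h1 : t ≤ 1) (k : Fin n) : 0 < (lb b b' t k).2 := by
  simpa [lb] using lin_pos (hb k) (hb' k) h0 h1

theorem SL_joined (L : List (Fin n)) (q : Amb n) (hq : q ∈ SL L) : JoinedIn (SL L) q (0, b0) := by
  obtain ⟨a, b⟩ := q
  refine (joinedIn_a hq (aL_mem L b hq.1)).trans (JoinedIn.trans ?_
    (joinedIn_a (aL_mem L b0 (fun _ => by simp [b0])) (b0_mem L 0)))
  refine joinedIn_of_fun (fun t => (aL L, lb b b0 t)) ?_ ?_ ?_ ?_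
  · unfold lb; fun_prop
  · ext k <;> simp [lb]
  · ext k <;> simp [lb]
  · intro t h0 h1
    exact aL_mem L _ (lb_pos _ _ hq.1 (fun _ => by simp [b0]) t h0 h1)

theorem UU_contractible (L : Ix n) : ContractibleSpace (UU n L) := by
  rw [contractible_iff_id_nullhomotopic]
  let mk : (q : Amb n) → q ∈ SL L.1 → UU n L := fun q h => ⟨⟨q, SL.isC L.2 h⟩, h⟩
  let f : C(UU n L, UU n L) := ⟨fun x => mk (aL L.1, x.1.1.2) (aL_mem _ _ x.2.1), by
    simp only [mk]; fun_prop⟩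
  refine ⟨mk (aL L.1, b0) (aL_mem _ _ fun _ => by simp [b0]), ?_⟩
  refine ContinuousMap.Homotopic.trans (g := f) ⟨⟨⟨fun p =>
    mk (fun i => (1 - (p.1 : ℝ)) * p.2.1.1.1 i + p.1 * aL L.1 i, p.2.1.1.2)
      (joined_a p.2.2 (aL_mem _ _ p.2.2.1) p.1 p.1.2.1 p.1.2.2), ?_⟩, ?_, ?_⟩⟩ ⟨⟨⟨fun p =>
    mk (aL L.1, lb p.2.1.1.2 b0 p.1) (aL_mem _ _ (lb_pos _ _ p.2.2.1 (fun _ => by simp [b0]) _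
      p.1.2.1 p.1.2.2)), ?_⟩, ?_, ?_⟩⟩
  · simp only [mk]; fun_prop
  · intro x
    apply Subtype.ext; apply Subtype.ext
    simp [mk]
  · intro x
    apply Subtype.ext; apply Subtype.ext
    simp [mk, f]
  · simp only [mk]; unfold lb; fun_prop
  · intro x
    apply Subtype.ext; apply Subtype.ext
    ext k <;> simp [mk, f, lb]
  · intro x
    apply Subtype.ext; apply Subtype.ext
    ext k <;> simp [mk, lb]

theorem UU_sc (L : Ix n) : IsSimplyConnected (UU n L) := by
  have := UU_contractible L
  exact (inferInstance : SimplyConnectedSpace (UU n L))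

variable (n) in
/-- The base point. -/
def pp : Conf n := ⟨(0, b0), fun _ => by simp [b0], fun i j h => Or.inr (Or.inl (b0_apart i j h))⟩

theorem pp_mem (L : Ix n) : pp n ∈ UU n L := b0_mem L.1 0

theorem exists_mem (x : Conf n) : ∃ L : Ix n, x ∈ UU n L := by
  let le : Fin n → Fin n → Bool := fun i j => decide (x.1.1 i ≤ x.1.1 j)
  let L := (List.finRange n).mergeSort le
  have hp : L.Perm (List.finRange n) := List.mergeSort_perm _ _
  have hnd : L.Nodup := hp.nodup_iff.2 (List.nodup_finRange n)
  have hok : Ok L := ⟨hnd, hp⟩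
  refine ⟨⟨L, hok⟩, x.2.1, ?_⟩
  have hs : L.Pairwise (fun i j => le i j = true) := by
    apply List.pairwise_mergeSort
    · intro a b c; simp only [le, decide_eq_true_eq]; exact le_trans
    · intro a b; simp only [le, Bool.or_eq_true, decide_eq_true_eq]; exact le_total _ _
  intro i j hij
  have h1 := (hok.pairwise_iff _).1 hs i j hij
  simp only [le, decide_eq_true_eq] at h1
  rcases x.2.2 i j (by rintro rfl; exact lt_irrefl _ hij) with h | h
  · exact Or.inl (lt_of_le_of_ne h1 h)
  · exact Or.inr h

theorem isOpen_apart : IsOpen {p : (ℂ × ℝ) × (ℂ × ℝ) | Apart p.1 p.2} := by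
  unfold Apart; exact isOpen_lt (by fun_prop) (by fun_prop)

theorem isOpen_nst : IsOpen {p : (ℂ × ℝ) × (ℂ × ℝ) | Nst p.1 p.2} := by
  unfold Nst; exact isOpen_lt (by fun_prop) (by fun_prop)

theorem isOpen_dj : IsOpen {p : (ℂ × ℝ) × (ℂ × ℝ) | Dj p.1 p.2} := by
  have h1 : IsOpen {p : (ℂ × ℝ) × (ℂ × ℝ) | Nst p.2 p.1} :=
    isOpen_nst.preimage (continuous_swap)
  exact isOpen_apart.union (isOpen_nst.union h1)

theorem UU_open (L : Ix n) : IsOpen (UU n L) := by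
  have : UU n L = ⋂ i, ⋂ j, {x : Conf n | QL L.1 i j → PP x.1 i j} := by
    ext x
    simp only [UU, SL, TT, mem_ofPred_eq, mem_iInter]
    exact ⟨fun h => h.2, fun h => ⟨x.2.1, h⟩⟩
  rw [this]
  refine isOpen_iInter_of_finite fun i => isOpen_iInter_of_finite fun j => ?_
  by_cases h : QL L.1 i j
  · simp only [h, forall_const]
    refine IsOpen.union (s₁ := {x : Conf n | x.1.1 i < x.1.1 j})
      (s₂ := {x : Conf n | Dj (x.1.2 i) (x.1.2 j)}) ?_ ?_
    · exact isOpen_lt (by fun_prop) (by fun_prop)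
    · exact isOpen_dj.preimage (f := fun x : Conf n => (x.1.2 i, x.1.2 j)) (by fun_prop)
  · simp [h]

theorem joined_pp (x : Conf n) : Joined x (pp n) := by
  obtain ⟨L, hL⟩ := exists_mem x
  exact (joinedIn_lift1 L (x := x) (y := pp n) (SL_joined L.1 x.1 hL)).joined

end RingModel

namespace RingModel
open Topology unitInterval Set YBList AbsCover

variable {n : ℕ}

open Classical in
/-- Total version of `gg`. -/
def GG (L M : List (Fin n)) (q : Amb n) : FundamentalGroup (Conf n) (pp n) :=
  if h : (Ok L ∧ Ok M) ∧ q ∈ SL L ∧ q ∈ SL M then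
    gg (UU_sc (n := n)) pp_mem ⟨L, h.1.1⟩ ⟨M, h.1.2⟩ (x := ⟨q, SL.isC h.1.1 h.2.1⟩) h.2.1 h.2.2
  else 1

theorem GG_eq {L M : List (Fin n)} {q : Amb n} (hL : Ok L) (hM : Ok M) (h : q ∈ SL L)
    (h' : q ∈ SL M) : GG L M q =
    gg (UU_sc (n := n)) pp_mem ⟨L, hL⟩ ⟨M, hM⟩ (x := ⟨q, SL.isC hL h⟩) h h' :=
  dif_pos ⟨⟨hL, hM⟩, h, h'⟩

theorem GG_comp {L M N : List (Fin n)} {q : Amb n} (hL : Ok L) (hM : Ok M) (hN : Ok N)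
    (h : q ∈ SL L) (h' : q ∈ SL M) (h'' : q ∈ SL N) : GG M N q * GG L M q = GG L N q := by
  rw [GG_eq hL hM h h', GG_eq hM hN h' h'', GG_eq hL hN h h'']
  exact gg_comp UU_sc pp_mem _ _ _ _ _ _

theorem GG_self {L : List (Fin n)} {q : Amb n} (hL : Ok L) (h : q ∈ SL L) : GG L L q = 1 := by
  rw [GG_eq hL hL h h]
  exact gg_self UU_sc pp_mem _ _

theorem GG_base {L M : List (Fin n)} (hL : Ok L) (hM : Ok M) : GG L M (0, b0) = 1 := by
  rw [GG_eq hL hM (b0_mem _ _) (b0_mem _ _)]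
  exact gg_base UU_sc pp_mem _ _

theorem GG_joined {L M : List (Fin n)} {q q' : Amb n} (hL : Ok L) (hM : Ok M)
    (h : JoinedIn (SL L ∩ SL M) q q') : GG L M q = GG L M q' := by
  rw [GG_eq hL hM h.source_mem.1 h.source_mem.2, GG_eq hL hM h.target_mem.1 h.target_mem.2]
  exact gg_joined UU_sc pp_mem _ _ _ _ _ _ (joinedIn_lift _ _ h)

/-- Removing the base nesting inside charts which agree on `i`, `j`. -/
theorem GG_bt_one {L M : List (Fin n)} (hL : Ok L) (hM : Ok M) (i j : Fin n) (hij : i ≠ j)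
    (h : QL L i j ↔ QL M i j) : GG L M (0, bt i j 1) = 1 := by
  rw [← GG_base hL hM]
  apply GG_joined hL hM
  have h0 : ∀ a : Fin n → ℝ, (a, bt i j 1) ∈ SL L ∩ SL M :=
    fun a => ⟨bt_mem _ _ _ _ hij, bt_mem _ _ _ _ hij⟩
  have h1 : ∀ a : Fin n → ℝ, (a, (b0 : Fin n → ℂ × ℝ)) ∈ SL L ∩ SL M :=
    fun a => ⟨b0_mem _ _, b0_mem _ _⟩
  have h2 : ∀ t, 0 ≤ t → t ≤ 1 → (aL L, bt i j t) ∈ SL L ∩ SL M := by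
    intro t t0 t1
    refine ⟨aL_mem _ _ (bt_pos i j t t0), bt_pos i j t t0, fun k l hkl => ?_⟩
    have hne : k ≠ l := by rintro rfl; exact lt_irrefl _ hkl
    by_cases c1 : k = i ∧ l = j
    · obtain ⟨rfl, rfl⟩ := c1
      exact Or.inl (by simpa [aL, QL] using h.2 hkl)
    by_cases c2 : k = j ∧ l = i
    · obtain ⟨rfl, rfl⟩ := c2
      refine Or.inl ?_
      rcases hL.total hne with h3 | h3
      · simpa [aL, QL] using h3
      · exact absurd (h.1 h3) (lt_asymm hkl)
    · exact Or.inr (Or.inl (bt_apart i j t t0 t1 k l hne c1 c2))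
  rw [SL_inter] at *
  refine (joinedIn_a (h0 0) (h0 (aL L))).trans (JoinedIn.trans ?_ (joinedIn_a (h1 (aL L)) (h1 0)))
  refine JoinedIn.symm (joinedIn_of_fun (fun t => (aL L, bt i j t)) ?_ ?_ rfl h2)
  · refine continuous_const.prodMk (continuous_pi fun k => ?_)
    simp only [bt]
    refine Continuous.prodMk ?_ ?_
    · split_ifs <;> fun_prop
    · split_ifs <;> fun_prop
  · simp [bt_zero]

/-- The admissible pairs of circles that are apart. -/
def Zap : Set ((ℂ × ℝ) × (ℂ × ℝ)) := {p | 0 < p.1.2 ∧ 0 < p.2.2 ∧ Apart p.1 p.2}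
/-- The admissible pairs of nested circles. -/
def Zne : Set ((ℂ × ℝ) × (ℂ × ℝ)) := {p | 0 < p.1.2 ∧ 0 < p.2.2 ∧ Nst p.1 p.2}

theorem Zne_joined {p q : (ℂ × ℝ) × (ℂ × ℝ)} (hp : p ∈ Zne) (hq : q ∈ Zne) : JoinedIn Zne p q := by
  refine joinedIn_of_fun (fun t => (1 - t) • p + t • q) (by fun_prop) (by simp) (by simp) ?_
  intro t h0 h1
  refine ⟨by simpa using lin_pos hp.1 hq.1 h0 h1, by simpa using lin_pos hp.2.1 hq.2.1 h0 h1, ?_⟩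
  have a := hp.2.2
  have b := hq.2.2
  unfold Nst at *
  have e : ((1 - t) • p + t • q).1.1 - ((1 - t) • p + t • q).2.1
    = (1 - t) • (p.1.1 - p.2.1) + t • (q.1.1 - q.2.1) := by
    simp only [Prod.fst_add, Prod.smul_fst, Prod.snd_add, Prod.smul_snd, smul_sub]
    abel
  have e2 : ‖(1 - t) • (p.1.1 - p.2.1) + t • (q.1.1 - q.2.1)‖ ≤
      (1 - t) * ‖p.1.1 - p.2.1‖ + t * ‖q.1.1 - q.2.1‖ := by
    refine (norm_add_le _ _).trans ?_
    rw [norm_smul, norm_smul, Real.norm_of_nonneg h0, Real.norm_of_nonneg (sub_nonneg.2 h1)]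
  rw [e]
  have := lin_pos (sub_pos.2 a) (sub_pos.2 b) h0 h1
  simp only [Prod.fst_add, Prod.smul_fst, Prod.snd_add, Prod.smul_snd, smul_eq_mul]
  nlinarith

theorem Zap_joined {p q : (ℂ × ℝ) × (ℂ × ℝ)} (hp : p ∈ Zap) (hq : q ∈ Zap) : JoinedIn Zap p q := by
  let W : Set ((ℂ × ℂ) × (ℝ × ℝ)) :=
    (univ ×ˢ {0}ᶜ) ×ˢ {s : ℝ × ℝ | 0 < s.1 ∧ 0 < s.2 ∧ s.1 + s.2 < 1}
  have hc : IsPathConnected {s : ℝ × ℝ | 0 < s.1 ∧ 0 < s.2 ∧ s.1 + s.2 < 1} := by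
    refine Convex.isPathConnected ?_ ⟨(1 / 4, 1 / 4), by norm_num⟩
    rintro ⟨s1, s2⟩ hs ⟨t1, t2⟩ ht a b ha hb hab
    obtain rfl : a = 1 - b := by linarith
    obtain ⟨x1, x2, x3⟩ := hs
    obtain ⟨y1, y2, y3⟩ := ht
    refine ⟨by simpa using lin_pos x1 y1 hb (by linarith),
      by simpa using lin_pos x2 y2 hb (by linarith), ?_⟩
    have := lin_pos (sub_pos.2 x3) (sub_pos.2 y3) hb (by linarith)
    simp at this ⊢
    nlinarith
  have hW : IsPathConnected W := by
    refine IsPathConnected.prod (IsPathConnected.prod isPathConnected_univ ?_) hc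
    apply isPathConnected_compl_singleton_of_one_lt_rank
    rw [Complex.rank_real_complex]
    norm_num
  let F : (ℂ × ℂ) × (ℝ × ℝ) → (ℂ × ℝ) × (ℂ × ℝ) := fun w =>
    ((w.1.1 + w.1.2, w.2.1 * ‖w.1.2‖), (w.1.1, w.2.2 * ‖w.1.2‖))
  have hF : Continuous F := by simp only [F]; fun_prop
  have hZ : F '' W = Zap := by
    ext p
    constructor
    · rintro ⟨w, ⟨⟨-, h1⟩, h2, h3, h4⟩, rfl⟩
      have hn : 0 < ‖w.1.2‖ := norm_pos_iff.2 h1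
      refine ⟨mul_pos h2 hn, mul_pos h3 hn, ?_⟩
      simp only [Apart, F, add_sub_cancel_left]
      nlinarith
    · rintro ⟨h1, h2, h3⟩
      unfold Apart at h3
      have hn : 0 < ‖p.1.1 - p.2.1‖ := by linarith
      refine ⟨((p.2.1, p.1.1 - p.2.1), (p.1.2 / ‖p.1.1 - p.2.1‖, p.2.2 / ‖p.1.1 - p.2.1‖)),
        ⟨⟨mem_univ _, norm_pos_iff.1 hn⟩, div_pos h1 hn, div_pos h2 hn, ?_⟩, ?_⟩
      · simp only
        rw [← add_div, div_lt_one hn]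
        exact h3
      · simp only [F]
        rw [div_mul_cancel₀ _ hn.ne', div_mul_cancel₀ _ hn.ne']
        simp
  rw [← hZ] at hp hq ⊢
  exact (hW.image hF).joinedIn _ hp _ hq

theorem joinedIn_pair (i j : Fin n) (hij : i ≠ j) {b b' : Fin n → ℂ × ℝ}
    (hb : ∀ k, 0 < (b k).2) (hb' : ∀ k, 0 < (b' k).2) {Z : Set ((ℂ × ℝ) × (ℂ × ℝ))}
    (h : JoinedIn Z (b i, b j) (b' i, b' j)) (hZ : ∀ p ∈ Z, 0 < p.1.2 ∧ 0 < p.2.2) :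
    JoinedIn {c : Fin n → ℂ × ℝ | (∀ k, 0 < (c k).2) ∧ (c i, c j) ∈ Z} b b' := by
  obtain ⟨γ, hγ⟩ := h
  refine ⟨⟨⟨fun t k => if k = i then (γ t).1 else if k = j then (γ t).2 else lb b b' t k, ?_⟩,
    ?_, ?_⟩, fun t => ⟨fun k => ?_, ?_⟩⟩
  · refine continuous_pi fun k => ?_
    unfold lb
    split_ifs <;> fun_prop
  · funext k
    simp only
    split_ifs with h1 h2
    · subst h1; simp
    · subst h2; simp
    · simp [lb]
  · funext k
    simp only
    split_ifs with h1 h2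
    · subst h1; simp
    · subst h2; simp
    · simp [lb]
  · simp only [ContinuousMap.coe_mk, Path.coe_mk_mk]
    split_ifs with h1 h2
    · exact (hZ _ (hγ t)).1
    · exact (hZ _ (hγ t)).2
    · exact lb_pos _ _ hb hb' _ t.2.1 t.2.2 k
  · simpa [hij.symm] using hγ t

theorem idx_adj {K N : List (Fin n)} {i j : Fin n} (h : Ok (K ++ i :: j :: N)) :
    (∀ k, k ≠ i → k ≠ j →
      (K ++ i :: j :: N).idxOf k = (K ++ j :: i :: N).idxOf k) ∧
    (K ++ i :: j :: N).idxOf i = K.length ∧ (K ++ i :: j :: N).idxOf j = K.length + 1 ∧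
    (K ++ j :: i :: N).idxOf j = K.length ∧ (K ++ j :: i :: N).idxOf i = K.length + 1 := by
  have h1 := h.1
  simp only [List.nodup_append, List.nodup_cons, List.mem_cons] at h1
  have hi : i ∉ K := fun hh => h1.2.2 i hh i (by simp) rfl
  have hj : j ∉ K := fun hh => h1.2.2 j hh j (by simp) rfl
  have hij : i ≠ j := fun hh => h1.2.1.1 (Or.inl hh)
  refine ⟨fun k hki hkj => ?_, ?_, ?_, ?_, ?_⟩
  · simp [List.idxOf_append, List.idxOf_cons, hki.symm, hkj.symm]
  · simp [List.idxOf_append, hi]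
  · simp [List.idxOf_append, hj, hij, add_comm]
  · simp [List.idxOf_append, hj]
  · simp [List.idxOf_append, hi, hij.symm, add_comm]

theorem Ok.swap {K N : List (Fin n)} {i j : Fin n} (h : Ok (K ++ i :: j :: N)) :
    Ok (K ++ j :: i :: N) := by
  have hp : (K ++ j :: i :: N).Perm (K ++ i :: j :: N) :=
    List.Perm.append_left _ (List.Perm.swap _ _ _)
  exact ⟨hp.nodup_iff.2 h.1, hp.trans h.2⟩

theorem Ok.adj_ne {K N : List (Fin n)} {i j : Fin n} (h : Ok (K ++ i :: j :: N)) : i ≠ j := by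
  have h1 := h.1
  simp only [List.nodup_append, List.nodup_cons, List.mem_cons] at h1
  exact fun hh => h1.2.1.1 (Or.inl hh)

/-- Moving inside the intersection of two adjacent charts. -/
theorem adj_joined {K N : List (Fin n)} {i j : Fin n} (h : Ok (K ++ i :: j :: N)) {q : Amb n}
    (hq : q ∈ SL (K ++ i :: j :: N) ∩ SL (K ++ j :: i :: N)) {b' : Fin n → ℂ × ℝ}
    (hb' : ∀ k, 0 < (b' k).2) (hd' : ∀ k l, k ≠ l → Dj (b' k) (b' l))
    {Z : Set ((ℂ × ℝ) × (ℂ × ℝ))}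
    (hZ : JoinedIn Z (q.2 i, q.2 j) (b' i, b' j))
    (hZp : ∀ p ∈ Z, 0 < p.1.2 ∧ 0 < p.2.2 ∧ Dj p.1 p.2) :
    JoinedIn (SL (K ++ i :: j :: N) ∩ SL (K ++ j :: i :: N)) q (0, b') := by
  obtain ⟨a, b⟩ := q
  have hij := h.adj_ne
  let a' : Fin n → ℝ := fun k => ((K ++ i :: j :: N).idxOf k + (K ++ j :: i :: N).idxOf k : ℕ)
  obtain ⟨e1, e2, e3, e4, e5⟩ := idx_adj h
  have key : ∀ c : Fin n → ℂ × ℝ, (∀ k, 0 < (c k).2) → Dj (c i) (c j) →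
      (a', c) ∈ SL (K ++ i :: j :: N) ∩ SL (K ++ j :: i :: N) := by
    intro c hc hd
    rw [SL_inter]
    refine ⟨hc, fun k l hkl => ?_⟩
    by_cases c1 : k = i ∧ l = j
    · obtain ⟨rfl, rfl⟩ := c1
      exact Or.inr hd
    by_cases c2 : k = j ∧ l = i
    · obtain ⟨rfl, rfl⟩ := c2
      exact Or.inr hd.symm
    left
    simp only [a', Nat.cast_lt]
    have hI := fun hh : List.idxOf k (K ++ i :: j :: N) = List.idxOf i (K ++ i :: j :: N) => h.inj hh
    have hJ := fun hh : List.idxOf k (K ++ i :: j :: N) = List.idxOf j (K ++ i :: j :: N) => h.inj hh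
    have hI' := fun hh : List.idxOf l (K ++ i :: j :: N) = List.idxOf i (K ++ i :: j :: N) => h.inj hh
    have hJ' := fun hh : List.idxOf l (K ++ i :: j :: N) = List.idxOf j (K ++ i :: j :: N) => h.inj hh
    unfold QL at hkl
    by_cases k1 : k = i
    · subst k1
      by_cases l2 : l = j
      · exact absurd ⟨rfl, l2⟩ c1
      · by_cases l1 : l = k
        · subst l1; simp at hkl
        · have := e1 l l1 l2
          have := mt hJ' l2
          omega
    · by_cases k2 : k = j
      · subst k2
        by_cases l1 : l = i
        · exact absurd ⟨rfl, l1⟩ c2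
        · by_cases l2 : l = k
          · subst l2; simp at hkl
          · have := e1 l l1 l2
            have := mt hI' l1
            omega
      · have := e1 k k1 k2
        have := mt hI k1
        have := mt hJ k2
        by_cases l1 : l = i
        · subst l1; omega
        · by_cases l2 : l = j
          · subst l2; omega
          · have := e1 l l1 l2
            omega
  have pos : ∀ k, 0 < (b k).2 := hq.1.1
  have m1 := key b pos (hZp _ hZ.source_mem).2.2
  have m2 := key b' hb' (hZp _ hZ.target_mem).2.2
  have m3 : ((0 : Fin n → ℝ), b') ∈ SL (K ++ i :: j :: N) ∩ SL (K ++ j :: i :: N) :=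
    ⟨mem_SL_of_dj _ _ hb' hd', mem_SL_of_dj _ _ hb' hd'⟩
  have j2 := joinedIn_pair i j hij pos hb' hZ (fun p hp => ⟨(hZp p hp).1, (hZp p hp).2.1⟩)
  rw [SL_inter] at *
  refine (joinedIn_a hq m1).trans (JoinedIn.trans ?_ (joinedIn_a m2 m3))
  exact joinedIn_b j2 fun c hc => key c hc.1 (hZp _ hc.2).2.2

/-- the remaining indices -/
def rest (l : List (Fin n)) : List (Fin n) := (List.finRange n).filter (fun k => k ∉ l)

theorem ok_rest (l : List (Fin n)) (h : l.Nodup) : Ok (l ++ rest l) := by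
  have hnd : (l ++ rest l).Nodup := by
    rw [List.nodup_append]
    refine ⟨h, (List.nodup_finRange n).filter _, fun a ha b hb => ?_⟩
    rintro rfl
    simp [rest] at hb
    exact hb ha
  refine ⟨hnd, ?_⟩
  rw [List.perm_ext_iff_of_nodup hnd (List.nodup_finRange n)]
  intro a
  simp only [rest, List.mem_append, List.mem_filter, List.mem_finRange, true_and,
    decide_eq_true_eq, iff_true]
  exact em _

/-- The loops. -/
def Aloop (i j : Fin n) : FundamentalGroup (Conf n) (pp n) :=
  GG (i :: j :: rest [i, j]) (j :: i :: rest [i, j]) (0, bt i j 1)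

theorem adj_nst {K N : List (Fin n)} {i j : Fin n} (h : Ok (K ++ i :: j :: N)) {q : Amb n}
    (hq : q ∈ SL (K ++ i :: j :: N)) (hq' : q ∈ SL (K ++ j :: i :: N))
    (hn : Nst (q.2 i) (q.2 j)) : GG (K ++ i :: j :: N) (K ++ j :: i :: N) q = Aloop i j := by
  have hij := h.adj_ne
  have hd := bt_dj i j hij
  have hp := bt_pos i j 1 zero_le_one
  rw [GG_joined h h.swap (adj_joined h ⟨hq, hq'⟩ hp hd (Z := Zne)
    (Zne_joined ⟨hq.1 i, hq.1 j, hn⟩ ⟨hp i, hp j, bt_nst i j hij⟩)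
    (fun p hp => ⟨hp.1, hp.2.1, Or.inr (Or.inl hp.2.2)⟩))]
  have o1 : Ok ([] ++ i :: j :: rest [i, j]) := ok_rest [i, j] (by simpa using hij)
  have o2 := o1.swap
  obtain ⟨-, e2, e3, e4, e5⟩ := idx_adj h
  obtain ⟨-, f2, f3, f4, f5⟩ := idx_adj o1
  have m := fun L => bt_mem L 0 i j hij
  have g1 := GG_bt_one h o1 i j hij (by unfold QL; omega)
  have g2 := GG_bt_one o2 h.swap i j hij (by unfold QL; omega)
  rw [← GG_comp h o1 h.swap (m _) (m _) (m _), g1, mul_one,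
    ← GG_comp o1 o2 h.swap (m _) (m _) (m _), g2, one_mul]
  rfl

theorem adj_nst' {K N : List (Fin n)} {i j : Fin n} (h : Ok (K ++ i :: j :: N)) {q : Amb n}
    (hq : q ∈ SL (K ++ i :: j :: N)) (hq' : q ∈ SL (K ++ j :: i :: N))
    (hn : Nst (q.2 j) (q.2 i)) :
    GG (K ++ i :: j :: N) (K ++ j :: i :: N) q = (Aloop j i)⁻¹ := by
  rw [← adj_nst h.swap hq' hq hn, eq_inv_iff_mul_eq_one, GG_comp h.swap h h.swap hq' hq hq',
    GG_self h.swap hq']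

theorem adj_apart {K N : List (Fin n)} {i j : Fin n} (h : Ok (K ++ i :: j :: N)) {q : Amb n}
    (hq : q ∈ SL (K ++ i :: j :: N)) (hq' : q ∈ SL (K ++ j :: i :: N))
    (hn : Apart (q.2 i) (q.2 j)) : GG (K ++ i :: j :: N) (K ++ j :: i :: N) q = 1 := by
  have hij := h.adj_ne
  have hp : ∀ k : Fin n, 0 < (b0 k).2 := fun _ => by simp [b0]
  rw [GG_joined h h.swap (adj_joined h ⟨hq, hq'⟩ hp (fun k l h => Or.inl (b0_apart k l h)) (Z := Zap)
    (Zap_joined ⟨hq.1 i, hq.1 j, hn⟩ ⟨hp i, hp j, b0_apart i j hij⟩)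
    (fun p hp => ⟨hp.1, hp.2.1, Or.inl hp.2.2⟩))]
  exact GG_base h h.swap

end RingModel

namespace RingModel
open Topology unitInterval Set YBList AbsCover

variable {n : ℕ}

/-- The relations of the presentation. -/
structure Rel {G : Type} [Group G] (A : Fin n → Fin n → G) : Prop where
  c4 : ∀ i j k l, i ≠ j → k ≠ l → i ≠ k → i ≠ l → j ≠ k → j ≠ l → A i j * A k l = A k l * A i j
  c3 : ∀ i j k, i ≠ k → j ≠ k → i ≠ j → A i k * A j k = A j k * A i k
  y : ∀ i j k, i ≠ j → i ≠ k → j ≠ k → A i j * A i k * A j k = A j k * A i k * A i j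

/-- heights for the relation points -/
def ar (l : List (Fin n)) (k : Fin n) : ℝ := if k ∈ l then -1 else ((rest l).idxOf k : ℕ)

theorem ar_mem (l l' : List (Fin n)) (hp : l'.Perm l) (b : Fin n → ℂ × ℝ) (hb : ∀ k, 0 < (b k).2)
    (hd : ∀ k ∈ l, ∀ m ∈ l, k ≠ m → Dj (b k) (b m)) : (ar l, b) ∈ SL (l' ++ rest l) := by
  refine ⟨hb, fun k m hkm => ?_⟩
  have hne : k ≠ m := by rintro rfl; exact lt_irrefl _ hkm
  unfold QL at hkm
  rw [List.idxOf_append, List.idxOf_append] at hkm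
  simp only [hp.mem_iff] at hkm
  by_cases hk : k ∈ l
  · by_cases hm : m ∈ l
    · exact Or.inr (hd k hk m hm hne)
    · left
      simp only [ar, hk, hm, if_true, if_false]
      have : (0 : ℝ) ≤ ((rest l).idxOf m : ℕ) := Nat.cast_nonneg _
      linarith
  · by_cases hm : m ∈ l
    · have := List.idxOf_lt_length_of_mem (hp.mem_iff.2 hm)
      simp only [hk, hm, if_true, if_false] at hkm
      omega
    · left
      simp only [hk, hm, if_false] at hkm
      simp only [ar, hk, hm, if_false, Nat.cast_lt]
      omega

theorem ar_ok (l l' : List (Fin n)) (hl : l.Nodup) (hp : l'.Perm l) : Ok (l' ++ rest l) := by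
  have h := ok_rest l hl
  have hp' : (l' ++ rest l).Perm (l ++ rest l) := hp.append_right _
  exact ⟨hp'.nodup_iff.2 h.1, hp'.trans h.2⟩

theorem yb_of_point (i j k : Fin n) (N : List (Fin n)) (q : Amb n)
    (hO : ∀ l' : List (Fin n), l'.Perm [i, j, k] → Ok (l' ++ N))
    (hM : ∀ l' : List (Fin n), l'.Perm [i, j, k] → q ∈ SL (l' ++ N))
    (X Y Z : FundamentalGroup (Conf n) (pp n))
    (hij : ∀ K M, Ok (K ++ i :: j :: M) → q ∈ SL (K ++ i :: j :: M) → q ∈ SL (K ++ j :: i :: M) →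
      GG (K ++ i :: j :: M) (K ++ j :: i :: M) q = X)
    (hik : ∀ K M, Ok (K ++ i :: k :: M) → q ∈ SL (K ++ i :: k :: M) → q ∈ SL (K ++ k :: i :: M) →
      GG (K ++ i :: k :: M) (K ++ k :: i :: M) q = Y)
    (hjk : ∀ K M, Ok (K ++ j :: k :: M) → q ∈ SL (K ++ j :: k :: M) → q ∈ SL (K ++ k :: j :: M) →
      GG (K ++ j :: k :: M) (K ++ k :: j :: M) q = Z) : Z * (Y * X) = X * (Y * Z) := by
  have p1 : [i, j, k].Perm [i, j, k] := List.Perm.refl _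
  have p2 : [j, i, k].Perm [i, j, k] := List.Perm.swap _ _ _
  have p3 : [j, k, i].Perm [i, j, k] := (List.Perm.cons _ (List.Perm.swap _ _ _)).trans p2
  have p4 : [k, j, i].Perm [i, j, k] := (List.Perm.swap _ _ _).trans p3
  have p5 : [i, k, j].Perm [i, j, k] := List.Perm.cons _ (List.Perm.swap _ _ _)
  have p6 : [k, i, j].Perm [i, j, k] := (List.Perm.swap _ _ _).trans p5
  rw [← hij [] (k :: N) (hO _ p1) (hM _ p1) (hM _ p2), ← hik [j] N (hO _ p2) (hM _ p2) (hM _ p3),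
    ← hjk [] (i :: N) (hO _ p3) (hM _ p3) (hM _ p4)]
  have e1 := GG_comp (hO _ p1) (hO _ p2) (hO _ p3) (hM _ p1) (hM _ p2) (hM _ p3)
  have e2 := GG_comp (hO _ p1) (hO _ p3) (hO _ p4) (hM _ p1) (hM _ p3) (hM _ p4)
  have e3 := GG_comp (hO _ p1) (hO _ p5) (hO _ p6) (hM _ p1) (hM _ p5) (hM _ p6)
  have e4 := GG_comp (hO _ p1) (hO _ p6) (hO _ p4) (hM _ p1) (hM _ p6) (hM _ p4)
  simp only [List.cons_append, List.nil_append] at e1 e2 e3 e4 ⊢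
  rw [e1, e2]
  have f1 := hjk [i] N (hO _ p1) (hM _ p1) (hM _ p5)
  have f2 := hik [] (j :: N) (hO _ p5) (hM _ p5) (hM _ p6)
  have f3 := hij [k] N (hO _ p6) (hM _ p6) (hM _ p4)
  have f4 := hij [] (k :: N) (hO _ p1) (hM _ p1) (hM _ p2)
  have f5 := hik [j] N (hO _ p2) (hM _ p2) (hM _ p3)
  have f6 := hjk [] (i :: N) (hO _ p3) (hM _ p3) (hM _ p4)
  simp only [List.cons_append, List.nil_append] at f1 f2 f3 f4 f5 f6
  rw [f4, f5, f6, ← f1, ← f2, ← f3, e3, e4]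

theorem comm_of_point (i j k l : Fin n) (N : List (Fin n)) (q : Amb n)
    (hO : ∀ l' : List (Fin n), l'.Perm [i, j, k, l] → Ok (l' ++ N))
    (hM : ∀ l' : List (Fin n), l'.Perm [i, j, k, l] → q ∈ SL (l' ++ N))
    (X Y : FundamentalGroup (Conf n) (pp n))
    (hij : ∀ K M, Ok (K ++ i :: j :: M) → q ∈ SL (K ++ i :: j :: M) → q ∈ SL (K ++ j :: i :: M) →
      GG (K ++ i :: j :: M) (K ++ j :: i :: M) q = X)
    (hkl : ∀ K M, Ok (K ++ k :: l :: M) → q ∈ SL (K ++ k :: l :: M) → q ∈ SL (K ++ l :: k :: M) →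
      GG (K ++ k :: l :: M) (K ++ l :: k :: M) q = Y) : X * Y = Y * X := by
  have p1 : [i, j, k, l].Perm [i, j, k, l] := List.Perm.refl _
  have p2 : [j, i, k, l].Perm [i, j, k, l] := List.Perm.swap _ _ _
  have p3 : [i, j, l, k].Perm [i, j, k, l] :=
    List.Perm.cons _ (List.Perm.cons _ (List.Perm.swap _ _ _))
  have p4 : [j, i, l, k].Perm [i, j, k, l] := (List.Perm.swap _ _ _).trans p3
  have e1 := GG_comp (hO _ p1) (hO _ p2) (hO _ p4) (hM _ p1) (hM _ p2) (hM _ p4)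
  have e2 := GG_comp (hO _ p1) (hO _ p3) (hO _ p4) (hM _ p1) (hM _ p3) (hM _ p4)
  have f1 := hij [] (k :: l :: N) (hO _ p1) (hM _ p1) (hM _ p2)
  have f2 := hkl [j, i] N (hO _ p2) (hM _ p2) (hM _ p4)
  have f3 := hkl [i, j] N (hO _ p1) (hM _ p1) (hM _ p3)
  have f4 := hij [] (l :: k :: N) (hO _ p3) (hM _ p3) (hM _ p4)
  simp only [List.cons_append, List.nil_append] at e1 e2 f1 f2 f3 f4
  rw [f1, f2] at e1
  rw [f3, f4] at e2
  rw [e1, e2]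

theorem Aloop_rel : Rel (Aloop (n := n)) := by
  refine ⟨fun i j k l hij hkl hik hil hjk hjl => ?_, fun i j k hik hjk hij => ?_,
    fun i j k hij hik hjk => ?_⟩
  · let b : Fin n → ℂ × ℝ := fun m => if m = i then (0, 1) else if m = j then (0, 2) else
      if m = k then (10, 1) else (10, 2)
    have bi : b i = (0, 1) := by simp [b]
    have bj : b j = (0, 2) := by simp [b, hij.symm]
    have bk : b k = (10, 1) := by simp [b, hik.symm, hjk.symm]
    have bl : b l = (10, 2) := by simp [b, hil.symm, hjl.symm, hkl.symm]
    have hb : ∀ m, 0 < (b m).2 := by intro m; simp only [b]; split_ifs <;> norm_num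
    have hnd : [i, j, k, l].Nodup := by simp [hij, hkl, hik, hil, hjk, hjl]
    have n1 : Nst (b i) (b j) := by rw [bi, bj]; unfold Nst; norm_num
    have n2 : Nst (b k) (b l) := by rw [bk, bl]; unfold Nst; norm_num
    have n3 : Apart (b i) (b k) := by rw [bi, bk]; unfold Apart; norm_num
    have n4 : Apart (b i) (b l) := by rw [bi, bl]; unfold Apart; norm_num
    have n5 : Apart (b j) (b k) := by rw [bj, bk]; unfold Apart; norm_num
    have n6 : Apart (b j) (b l) := by rw [bj, bl]; unfold Apart; norm_num
    have hd : ∀ s ∈ [i, j, k, l], ∀ m ∈ [i, j, k, l], s ≠ m → Dj (b s) (b m) := by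
      intro s hs m hm hsm
      simp only [List.mem_cons, List.not_mem_nil, or_false] at hs hm
      have := n3.symm
      have := n4.symm
      have := n5.symm
      have := n6.symm
      unfold Dj
      rcases hs with rfl | rfl | rfl | rfl <;> rcases hm with rfl | rfl | rfl | rfl <;> tauto
    exact comm_of_point i j k l (rest [i, j, k, l]) (ar [i, j, k, l], b)
      (fun l' h => ar_ok _ l' hnd h) (fun l' h => ar_mem _ l' h b hb hd) _ _
      (fun K M h1 h2 h3 => adj_nst h1 h2 h3 n1) (fun K M h1 h2 h3 => adj_nst h1 h2 h3 n2)
  · let b : Fin n → ℂ × ℝ := fun m => if m = i then (0, 1) else if m = j then (10, 1) else (0, 100)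
    have bi : b i = (0, 1) := by simp [b]
    have bj : b j = (10, 1) := by simp [b, hij.symm]
    have bk : b k = (0, 100) := by simp [b, hik.symm, hjk.symm]
    have hb : ∀ m, 0 < (b m).2 := by intro m; simp only [b]; split_ifs <;> norm_num
    have hnd : [i, j, k].Nodup := by simp [hij, hik, hjk]
    have n1 : Nst (b i) (b k) := by rw [bi, bk]; unfold Nst; norm_num
    have n2 : Nst (b j) (b k) := by rw [bj, bk]; unfold Nst; norm_num
    have n3 : Apart (b i) (b j) := by rw [bi, bj]; unfold Apart; norm_num
    have hd : ∀ s ∈ [i, j, k], ∀ m ∈ [i, j, k], s ≠ m → Dj (b s) (b m) := by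
      intro s hs m hm hsm
      simp only [List.mem_cons, List.not_mem_nil, or_false] at hs hm
      have := n3.symm
      unfold Dj
      rcases hs with rfl | rfl | rfl <;> rcases hm with rfl | rfl | rfl <;> tauto
    have := yb_of_point i j k (rest [i, j, k]) (ar [i, j, k], b)
      (fun l' h => ar_ok _ l' hnd h) (fun l' h => ar_mem _ l' h b hb hd) _ _ _
      (fun K M h1 h2 h3 => adj_apart h1 h2 h3 n3) (fun K M h1 h2 h3 => adj_nst h1 h2 h3 n1)
      (fun K M h1 h2 h3 => adj_nst h1 h2 h3 n2)
    rw [mul_one, one_mul] at this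
    exact this.symm
  · let b : Fin n → ℂ × ℝ := fun m => if m = i then (0, 1) else if m = j then (0, 2) else (0, 3)
    have bi : b i = (0, 1) := by simp [b]
    have bj : b j = (0, 2) := by simp [b, hij.symm]
    have bk : b k = (0, 3) := by simp [b, hik.symm, hjk.symm]
    have hb : ∀ m, 0 < (b m).2 := by intro m; simp only [b]; split_ifs <;> norm_num
    have hnd : [i, j, k].Nodup := by simp [hij, hik, hjk]
    have n1 : Nst (b i) (b k) := by rw [bi, bk]; unfold Nst; norm_num
    have n2 : Nst (b j) (b k) := by rw [bj, bk]; unfold Nst; norm_num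
    have n3 : Nst (b i) (b j) := by rw [bi, bj]; unfold Nst; norm_num
    have hd : ∀ s ∈ [i, j, k], ∀ m ∈ [i, j, k], s ≠ m → Dj (b s) (b m) := by
      intro s hs m hm hsm
      simp only [List.mem_cons, List.not_mem_nil, or_false] at hs hm
      unfold Dj
      rcases hs with rfl | rfl | rfl <;> rcases hm with rfl | rfl | rfl <;> tauto
    have := yb_of_point i j k (rest [i, j, k]) (ar [i, j, k], b)
      (fun l' h => ar_ok _ l' hnd h) (fun l' h => ar_mem _ l' h b hb hd) _ _ _
      (fun K M h1 h2 h3 => adj_nst h1 h2 h3 n3) (fun K M h1 h2 h3 => adj_nst h1 h2 h3 n1)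
      (fun K M h1 h2 h3 => adj_nst h1 h2 h3 n2)
    rw [mul_assoc, mul_assoc]
    exact this.symm

open Classical in
/-- The local crossing weights. -/
def RR {G : Type} [Group G] (A : Fin n → Fin n → G) (q : Amb n) (i j : Fin n) : G :=
  if Nst (q.2 i) (q.2 j) then A i j else if Nst (q.2 j) (q.2 i) then (A j i)⁻¹ else 1

section
variable {G : Type} [Group G] (A : Fin n → Fin n → G) (q : Amb n)

theorem RR_nst {i j : Fin n} (h : Nst (q.2 i) (q.2 j)) : RR A q i j = A i j := if_pos h

theorem RR_nst' {i j : Fin n} (h : Nst (q.2 j) (q.2 i)) : RR A q i j = (A j i)⁻¹ := by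
  rw [RR, if_neg h.asymm, if_pos h]

theorem RR_apart (hq : ∀ i, 0 < (q.2 i).2) {i j : Fin n} (h : Apart (q.2 i) (q.2 j)) :
    RR A q i j = 1 := by
  rw [RR, if_neg (h.not_nst (hq i)), if_neg (h.symm.not_nst (hq j))]

theorem RR_inv (hq : ∀ i, 0 < (q.2 i).2) {i j : Fin n} (h : Dj (q.2 i) (q.2 j)) :
    RR A q i j * RR A q j i = 1 := by
  rcases h with h | h | h
  · rw [RR_apart A q hq h, RR_apart A q hq h.symm, one_mul]
  · rw [RR_nst A q h, RR_nst' A q h, mul_inv_cancel]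
  · rw [RR_nst A q h, RR_nst' A q h, inv_mul_cancel]

theorem yb_swap12 {x xi y z : G} (hx : x * xi = 1) (h : z * y * x = x * y * z) :
    y * z * xi = xi * z * y := by
  obtain rfl : xi = x⁻¹ := (inv_eq_of_mul_eq_one_right hx).symm
  rw [mul_inv_eq_iff_eq_mul]
  have : x * (y * z) = x * (x⁻¹ * z * y * x) := by
    rw [← mul_assoc, ← h]; group
  exact mul_left_cancel this

theorem yb_swap23 {x y z zi : G} (hz : z * zi = 1) (h : z * y * x = x * y * z) :
    zi * x * y = y * x * zi := by
  obtain rfl : zi = z⁻¹ := (inv_eq_of_mul_eq_one_right hz).symm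
  rw [eq_mul_inv_iff_mul_eq]
  have : z * (z⁻¹ * x * y * z) = z * (y * x) := by
    rw [← mul_assoc z y x, h]; group
  exact mul_left_cancel this

/-- All possible nesting patterns of three circles, up to order. -/
theorem RR_yb (hA : Rel A) (hq : ∀ i, 0 < (q.2 i).2) (i j k : Fin n) (hij : i ≠ j) (hik : i ≠ k)
    (hjk : j ≠ k) (dij : Dj (q.2 i) (q.2 j)) (dik : Dj (q.2 i) (q.2 k)) (djk : Dj (q.2 j) (q.2 k)) :
    RR A q j k * RR A q i k * RR A q i j = RR A q i j * RR A q i k * RR A q j k := by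
  have chain : ∀ i j k, i ≠ j → i ≠ k → j ≠ k → Nst (q.2 i) (q.2 j) → Nst (q.2 j) (q.2 k) →
      RR A q j k * RR A q i k * RR A q i j = RR A q i j * RR A q i k * RR A q j k := by
    intro i j k hij hik hjk h1 h2
    rw [RR_nst A q h1, RR_nst A q h2, RR_nst A q (h1.trans h2)]
    exact (hA.y i j k hij hik hjk).symm
  have s12 : ∀ i j k, Dj (q.2 i) (q.2 j) →
      RR A q j k * RR A q i k * RR A q i j = RR A q i j * RR A q i k * RR A q j k →
      RR A q i k * RR A q j k * RR A q j i = RR A q j i * RR A q j k * RR A q i k :=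
    fun i j k d h => yb_swap12 (RR_inv A q hq d) h
  have s23 : ∀ i j k, Dj (q.2 j) (q.2 k) →
      RR A q j k * RR A q i k * RR A q i j = RR A q i j * RR A q i k * RR A q j k →
      RR A q k j * RR A q i j * RR A q i k = RR A q i k * RR A q i j * RR A q k j :=
    fun i j k d h => yb_swap23 (RR_inv A q hq d) h
  rcases dij with d1 | d1 | d1 <;> rcases djk with d3 | d3 | d3
  · rw [RR_apart A q hq d1, RR_apart A q hq d3, one_mul]
  · rcases dik with d2 | d2 | d2
    · rw [RR_apart A q hq d1, RR_apart A q hq d2]; simp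
    · rw [RR_apart A q hq d1, RR_nst A q d2, RR_nst A q d3]
      simpa using (hA.c3 i j k hik hjk hij).symm
    · exact absurd (d3.trans d2) (d1.symm.not_nst (hq j))
  · rcases dik with d2 | d2 | d2
    · rw [RR_apart A q hq d1, RR_apart A q hq d2]; simp
    · exact absurd (d2.trans d3) (d1.not_nst (hq i))
    · exact absurd d1 (d2.not_apart d3 (hq k))
  · rcases dik with d2 | d2 | d2
    · rw [RR_apart A q hq d2, RR_apart A q hq d3]; simp
    · exact absurd d3 (d1.not_apart d2 (hq i))
    · exact absurd (d2.trans d1) (d3.symm.not_nst (hq k))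
  · exact chain i j k hij hik hjk d1 d3
  · rcases dik with d2 | d2 | d2
    · rw [RR_apart A q hq d2, RR_nst A q d1, RR_nst' A q d3]
      have : Commute (A i j) (A k j) := hA.c3 i k j hij hjk.symm hik
      rw [mul_one, mul_one]
      exact this.inv_right.symm.eq
    · exact s23 i k j (Or.inr (Or.inl d3)) (chain i k j hik hij hjk.symm d2 d3)
    · exact s23 i k j (Or.inr (Or.inl d3)) (s12 k i j (Or.inr (Or.inl d2))
        (chain k i j hik.symm hjk.symm hij d2 d1))
  · rcases dik with d2 | d2 | d2
    · rw [RR_apart A q hq d2, RR_apart A q hq d3]; simp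
    · exact absurd (d1.trans d2) (d3.not_nst (hq j))
    · rw [RR_apart A q hq d3, RR_nst' A q d1, RR_nst' A q d2]
      have : Commute (A j i) (A k i) := hA.c3 j k i hij.symm hik.symm hjk
      rw [one_mul, mul_one]
      exact this.inv_inv.symm.eq
  · rcases dik with d2 | d2 | d2
    · exact absurd d2 (d1.not_apart d3 (hq j))
    · exact s12 j i k (Or.inr (Or.inl d1)) (chain j i k hij.symm hjk hik d1 d2)
    · exact s12 j i k (Or.inr (Or.inl d1)) (s23 j k i (Or.inr (Or.inl d2))
        (chain j k i hjk hij.symm hik.symm d3 d2))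
  · have d2 := d3.trans d1
    exact s12 j i k (Or.inr (Or.inl d1)) (s23 j k i (Or.inr (Or.inl d2))
      (s12 k j i (Or.inr (Or.inl d3)) (chain k j i hjk.symm hik.symm hij.symm d3 d1)))

theorem RR_YB (hA : Rel A) (hq : ∀ i, 0 < (q.2 i).2) : YB (RR A q) (PP q) := by
  refine ⟨fun i j _ h1 h2 => RR_inv A q hq (h1.dj h2), fun i j k hij hik hjk h1 h2 h3 h4 h5 h6 =>
    RR_yb A q hA hq i j k hij hik hjk (h1.dj h2) (h3.dj h4) (h5.dj h6),
    fun i j k l hij hik hil hjk hjl hkl h1 h2 h3 h4 => ?_⟩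
  have c1 : Commute (A i j) (A k l) := hA.c4 i j k l hij hkl hik hil hjk hjl
  have c2 : Commute (A j i) (A k l) := hA.c4 j i k l hij.symm hkl hjk hjl hik hil
  have c3 : Commute (A i j) (A l k) := hA.c4 i j l k hij hkl.symm hil hik hjl hjk
  have c4 : Commute (A j i) (A l k) := hA.c4 j i l k hij.symm hkl.symm hjl hjk hil hik
  change Commute (RR A q i j) (RR A q k l)
  rcases h1.dj h2 with d | d | d
  · rw [RR_apart A q hq d]; exact Commute.one_left _
  · rw [RR_nst A q d]
    rcases h3.dj h4 with e | e | e
    · rw [RR_apart A q hq e]; exact Commute.one_right _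
    · rw [RR_nst A q e]; exact c1
    · rw [RR_nst' A q e]; exact c3.inv_right
  · rw [RR_nst' A q d]
    rcases h3.dj h4 with e | e | e
    · rw [RR_apart A q hq e]; exact Commute.one_right _
    · rw [RR_nst A q e]; exact c2.inv_left
    · rw [RR_nst' A q e]; exact c4.inv_inv

theorem mem_SS {L : List (Fin n)} (hL : Ok L) (h : q ∈ SL L) :
    SS (PP q) (List.finRange n) L :=
  ⟨(hL.pairwise_iff _).2 h.2, hL.1, hL.2⟩

theorem SS_ok {L : List (Fin n)} (h : SS (PP q) (List.finRange n) L) : Ok L := h.2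

theorem SS_mem (hq : ∀ i, 0 < (q.2 i).2) {L : List (Fin n)}
    (h : SS (PP q) (List.finRange n) L) : q ∈ SL L :=
  ⟨hq, ((SS_ok q h).pairwise_iff _).1 h.1⟩

theorem RR_loc (x : Conf n) : ∀ᶠ y : Conf n in 𝓝 x, ∀ i j, Dj (x.1.2 i) (x.1.2 j) →
    RR A y.1 i j = RR A x.1 i j := by
  rw [Filter.eventually_all]; intro i
  rw [Filter.eventually_all]; intro j
  have hc : Continuous fun y : Conf n => (y.1.2 i, y.1.2 j) := by fun_prop
  have hc' : Continuous fun y : Conf n => (y.1.2 j, y.1.2 i) := by fun_prop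
  by_cases h : Dj (x.1.2 i) (x.1.2 j)
  · rcases h with h | h | h
    · filter_upwards [(isOpen_apart.preimage hc).mem_nhds h] with y hy _
      rw [RR_apart A y.1 y.2.1 hy, RR_apart A x.1 x.2.1 h]
    · filter_upwards [(isOpen_nst.preimage hc).mem_nhds h] with y hy _
      rw [RR_nst A y.1 hy, RR_nst A x.1 h]
    · filter_upwards [(isOpen_nst.preimage hc').mem_nhds h] with y hy _
      rw [RR_nst' A y.1 hy, RR_nst' A x.1 h]
  · exact Filter.Eventually.of_forall fun y hy => absurd hy h

/-- The cocycle. -/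
def coc (hA : Rel A) : Cocyc (UU n) G where
  w L M x := wl (RR A x.1) L.1 M.1
  hself L x := wl_self _ _
  hcomp L M N x h1 h2 h3 := wl_comp _ _ (RR_YB A x.1 hA x.2.1) _ _ _
    (mem_SS _ L.2 h1) (mem_SS _ M.2 h2) (mem_SS _ N.2 h3)
  hloc L M x h1 h2 := by
    filter_upwards [RR_loc A x] with y hy
    exact wl_congr _ (PP x.1) _ _ _ (mem_SS _ L.2 h1).1 (mem_SS _ M.2 h2).1 M.2.1
      (L.2.2.trans M.2.2.symm) (fun i j _ h h' => hy i j (h.dj h'))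
  hopen := UU_open
  at_ x := (exists_mem x).choose
  mem_at x := (exists_mem x).choose_spec

end

theorem GG_wl (q : Amb n) (L M : List (Fin n)) (hL : Ok L) (hM : Ok M) (h : q ∈ SL L)
    (h' : q ∈ SL M) : GG L M q = wl (RR Aloop q) L M := by
  have := eq_wl (R := RR Aloop q) (P := PP q) (L₀ := List.finRange n) (fun L M => GG L M q)
    (fun L hL => GG_self (SS_ok q hL) (SS_mem q h.1 hL))
    (fun L M N hL hM hN => GG_comp (SS_ok q hL) (SS_ok q hM) (SS_ok q hN) (SS_mem q h.1 hL)
      (SS_mem q h.1 hM) (SS_mem q h.1 hN))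
    (fun K i j N h1 h2 => by
      have o := SS_ok q h1
      have m1 := SS_mem q h.1 h1
      have m2 := SS_mem q h.1 h2
      have e := idx_adj o
      have d : Dj (q.2 i) (q.2 j) :=
        (m1.2 i j (by unfold QL; omega)).dj (m2.2 j i (by unfold QL; omega))
      rcases d with d | d | d
      · rw [RR_apart _ _ h.1 d]; exact adj_apart o m1 m2 d
      · rw [RR_nst _ _ d]; exact adj_nst o m1 m2 d
      · rw [RR_nst' _ _ d]; exact adj_nst' o m1 m2 d)
    L [] M (mem_SS q hL h) (mem_SS q hM h') (hL.2.trans hM.2.symm)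
  simpa using this

end RingModel

namespace RingModel
open Topology unitInterval Set YBList AbsCover

variable {n : ℕ}

open Classical in
/-- The generators in the presented group. -/
def alp (i j : Fin n) : PresentedGroup (purRels n) :=
  if h : i ≠ j then PresentedGroup.of ⟨(i, j), h⟩ else 1

theorem alp_eq (i j : Fin n) (h : i ≠ j) :
    alp i j = PresentedGroup.mk (purRels n) (gα i j h) := by
  rw [alp, dif_pos h]; rfl

theorem alp_rel : Rel (alp (n := n)) := by
  refine ⟨fun i j k l hij hkl hik hil hjk hjl => ?_, fun i j k hik hjk hij => ?_,
    fun i j k hij hik hjk => ?_⟩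
  · rw [alp_eq i j hij, alp_eq k l hkl, ← map_mul, ← map_mul, ← mul_inv_eq_one, ← map_inv,
      ← map_mul]
    apply PresentedGroup.one_of_mem
    left; left
    simp only [mem_iUnion]
    exact ⟨i, j, k, l, hij, hkl, hik, hil, hjk, hjl, rfl⟩
  · rw [alp_eq i k hik, alp_eq j k hjk, ← map_mul, ← map_mul, ← mul_inv_eq_one, ← map_inv,
      ← map_mul]
    apply PresentedGroup.one_of_mem
    left; right
    simp only [mem_iUnion]
    exact ⟨i, j, k, hik, hjk, hij, rfl⟩
  · rw [alp_eq i j hij, alp_eq i k hik, alp_eq j k hjk, ← map_mul, ← map_mul, ← map_mul,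
      ← map_mul, ← mul_inv_eq_one, ← map_inv, ← map_mul]
    apply PresentedGroup.one_of_mem
    right
    simp only [mem_iUnion]
    exact ⟨i, j, k, hij, hik, hjk, rfl⟩

theorem Aloop_relators : ∀ r ∈ purRels n,
    FreeGroup.lift (fun p : AGen n => Aloop p.1.1 p.1.2) r = 1 := by
  have hA := Aloop_rel (n := n)
  rintro r ((hr | hr) | hr)
  · simp only [mem_iUnion] at hr
    obtain ⟨i, j, k, l, hij, hkl, hik, hil, hjk, hjl, hr⟩ := hr
    rw [mem_singleton_iff] at hr
    subst hr
    simp only [gα, map_mul, map_inv, FreeGroup.lift_apply_of]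
    rw [hA.c4 i j k l hij hkl hik hil hjk hjl, mul_inv_cancel]
  · simp only [mem_iUnion] at hr
    obtain ⟨i, j, k, hik, hjk, hij, hr⟩ := hr
    rw [mem_singleton_iff] at hr
    subst hr
    simp only [gα, map_mul, map_inv, FreeGroup.lift_apply_of]
    rw [hA.c3 i j k hik hjk hij, mul_inv_cancel]
  · simp only [mem_iUnion] at hr
    obtain ⟨i, j, k, hij, hik, hjk, hr⟩ := hr
    rw [mem_singleton_iff] at hr
    subst hr
    simp only [gα, map_mul, map_inv, FreeGroup.lift_apply_of]
    rw [hA.y i j k hij hik hjk, mul_inv_cancel]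

variable (n) in
/-- The comparison homomorphism. -/
def Psi : PresentedGroup (purRels n) →* FundamentalGroup (Conf n) (pp n) :=
  PresentedGroup.toGroup Aloop_relators

theorem Psi_alp (i j : Fin n) (h : i ≠ j) : Psi n (alp i j) = Aloop i j := by
  rw [alp, dif_pos h, Psi, PresentedGroup.toGroup.of]

theorem Psi_RR (q : Amb n) : (fun i j => Psi n (RR alp q i j)) = RR Aloop q := by
  funext i j
  unfold RR
  split_ifs with h1 h2
  · refine Psi_alp i j ?_
    rintro rfl
    exact h1.asymm h1
  · rw [map_inv, Psi_alp j i ?_]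
    rintro rfl
    exact h2.asymm h2
  · exact map_one _

theorem Psi_bij : Function.Bijective (Psi n) := by
  refine bijective_of_cocyc (coc alp alp_rel) UU_sc pp_mem ?_ (Psi n) ?_ ?_
  · intro L M
    have : RR (alp (n := n)) (pp n).1 = fun _ _ => 1 := by
      funext i j
      by_cases h : i = j
      · subst h
        have h1 : ¬ Nst ((pp n).1.2 i) ((pp n).1.2 i) := fun h => h.asymm h
        rw [RR, if_neg h1, if_neg h1]
      · exact RR_apart _ _ (pp n).2.1 (b0_apart i j h)
    change wl (RR alp (pp n).1) L.1 M.1 = 1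
    rw [this, wl_one]
  · intro L M x hL hM
    change Psi n (wl (RR alp x.1) L.1 M.1) = _
    rw [map_wl, Psi_RR, ← GG_wl x.1 L.1 M.1 L.2 M.2 hL hM, GG_eq L.2 M.2 hL hM]
  · intro H hH u
    have : ∀ i j : Fin n, i ≠ j → alp i j ∈ H := by
      intro i j hij
      have o1 : Ok ([] ++ i :: j :: rest [i, j]) := ok_rest [i, j] (by simpa using hij)
      have m := fun L => bt_mem L 0 i j hij
      have := hH ⟨_, o1⟩ ⟨_, o1.swap⟩ ⟨(0, bt i j 1), SL.isC o1 (m _)⟩ (m _) (m _)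
      change wl (RR alp _) ([] ++ i :: j :: rest [i, j]) ([] ++ j :: i :: rest [i, j]) ∈ H at this
      rwa [wl_adj_eq _ _ _ _ _ o1.1, RR_nst _ _ (bt_nst i j hij)] at this
    have h2 : Subgroup.closure (Set.range (PresentedGroup.of (rels := purRels n))) ≤ H := by
      rw [Subgroup.closure_le]
      rintro _ ⟨⟨⟨i, j⟩, hij⟩, rfl⟩
      have := this i j hij
      rwa [alp, dif_pos hij] at this
    rw [PresentedGroup.closure_range_of] at h2
    exact h2 (Subgroup.mem_top u)

theorem conf_iso (x : Conf n) :
    Nonempty (FundamentalGroup (Conf n) x ≃* PresentedGroup (purRels n)) := by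
  obtain ⟨γ⟩ := joined_pp x
  exact ⟨(FundamentalGroup.fundamentalGroupMulEquivOfPath γ).trans
    (MulEquiv.ofBijective (Psi n) Psi_bij).symm⟩

end RingModel

namespace RingModel
open Topology unitInterval Set

/-- A map with a section which is a retraction along paths from `x` induces an isomorphism. -/
theorem map_bij {X Y : Type} [TopologicalSpace X] [TopologicalSpace Y] (F : C(X, Y)) (S : C(Y, X))
    (x : X) (hFS : ∀ y, F (S y) = y) (hx : S (F x) = x)
    (hp : ∀ (γ : Path x x) t, S (F (γ t)) = γ t) :
    Function.Bijective (FundamentalGroup.map F x) := by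
  constructor
  · apply Function.LeftInverse.injective (g := FundamentalGroup.mapOfEq S hx)
    intro p
    rw [FundamentalGroup.mapOfEq_apply]
    induction p using Path.Homotopic.Quotient.ind with
    | mk γ =>
      have : ((γ.map F.continuous).map S.continuous).cast hx.symm hx.symm = γ := by
        ext t; exact hp γ t
      conv_rhs => rw [← this]
      rfl
  · intro p
    induction p using Path.Homotopic.Quotient.ind with
    | mk γ =>
      refine ⟨FundamentalGroup.fromPath
        (Path.Homotopic.Quotient.mk ((γ.map S.continuous).cast hx.symm hx.symm)), ?_⟩
      have : (((γ.map S.continuous).cast hx.symm hx.symm).map F.continuous) = γ := by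
        ext t; exact hFS _
      conv_rhs => rw [← this]
      rfl

/-- The planar part of a point. -/
def pr (x : E3) : ℂ := ⟨x 1, x 2⟩

theorem norm_eq_pr (x c : E3) (h : x 0 = c 0) : ‖x - c‖ = ‖pr x - pr c‖ := by
  rw [EuclideanSpace.norm_eq, Complex.norm_eq_sqrt_sq_add_sq]
  simp [Fin.sum_univ_three, h, pr]

theorem inner_flat (x : E3) (w : E3) (h1 : w 1 = 0) (h2 : w 2 = 0) (h0 : w 0 ≠ 0) :
    inner ℝ x w = (0 : ℝ) ↔ x 0 = 0 := by
  simp [PiLp.inner_apply, Fin.sum_univ_three, h1, h2, h0]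

theorem norm_flat (w : E3) (h1 : w 1 = 0) (h2 : w 2 = 0) : ‖w‖ = |w 0| := by
  rw [EuclideanSpace.norm_eq]
  simp [Fin.sum_univ_three, h1, h2, Real.sqrt_sq_eq_abs]

/-- Flat nondegenerate parameters. -/
def Flat (p : E3 × E3) : Prop := p.2 1 = 0 ∧ p.2 2 = 0 ∧ p.2 0 ≠ 0

/-- The planar circle of a parameter. -/
def pl (p : E3 × E3) : ℂ × ℝ := (pr p.1, |p.2 0|)

theorem mem_circle {p : E3 × E3} (h : Flat p) (x : E3) :
    x ∈ pCircle p ↔ x 0 = p.1 0 ∧ ‖pr x - (pl p).1‖ = (pl p).2 := by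
  obtain ⟨h1, h2, h0⟩ := h
  unfold pCircle circleSet
  rw [Set.mem_ofPred_eq, inner_flat _ _ h1 h2 h0, norm_flat _ h1 h2]
  constructor
  · rintro ⟨a, b⟩
    have b' : x 0 = p.1 0 := by simpa [sub_eq_zero] using b
    exact ⟨b', by rw [norm_eq_pr _ _ b'] at a; exact a⟩
  · rintro ⟨a, b⟩
    exact ⟨by rw [norm_eq_pr _ _ a]; exact b, by simp [a]⟩

theorem mem_disk {p : E3 × E3} (h : Flat p) (x : E3) :
    x ∈ pDisk p ↔ x 0 = p.1 0 ∧ ‖pr x - (pl p).1‖ ≤ (pl p).2 := by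
  obtain ⟨h1, h2, h0⟩ := h
  unfold pDisk diskSet
  rw [Set.mem_ofPred_eq, inner_flat _ _ h1 h2 h0, norm_flat _ h1 h2]
  constructor
  · rintro ⟨a, b⟩
    have b' : x 0 = p.1 0 := by simpa [sub_eq_zero] using b
    exact ⟨b', by rw [norm_eq_pr _ _ b'] at a; exact a⟩
  · rintro ⟨a, b⟩
    exact ⟨by rw [norm_eq_pr _ _ a]; exact b, by simp [a]⟩

theorem exists_inter (u v : ℂ × ℝ) (hu : 0 < u.2) (hv : 0 < v.2) (h : ¬ Dj u v) :
    ∃ y : ℂ, ‖y - u.1‖ = u.2 ∧ ‖y - v.1‖ = v.2 := by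
  unfold Dj Apart Nst at h
  push Not at h
  obtain ⟨h1, h2, h3⟩ := h
  rw [norm_sub_rev v.1 u.1] at h3
  obtain ⟨z, r⟩ := u
  obtain ⟨w, s⟩ := v
  simp only at *
  by_cases hd : z = w
  · subst hd
    simp only [sub_self, norm_zero, zero_add] at h2 h3
    refine ⟨z + (r : ℂ), ?_, ?_⟩ <;>
    · simp only [add_sub_cancel_left, Complex.norm_real, Real.norm_eq_abs, abs_of_pos hu]
      try linarith
  · set d := ‖z - w‖ with hdd
    have hd0 : 0 < d := norm_pos_iff.2 (sub_ne_zero.2 hd)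
    have hdc : (d : ℂ) ≠ 0 := by exact_mod_cast hd0.ne'
    set a := (d ^ 2 + r ^ 2 - s ^ 2) / (2 * d) with ha
    have had : a * (2 * d) = d ^ 2 + r ^ 2 - s ^ 2 := by rw [ha]; field_simp
    have hb : 0 ≤ r ^ 2 - a ^ 2 := by
      have e1 : a ≤ r := by
        rw [ha, div_le_iff₀ (by positivity)]; nlinarith
      have e2 : -r ≤ a := by
        rw [ha, le_div_iff₀ (by positivity)]; nlinarith
      nlinarith
    have hbs := Real.sq_sqrt hb
    set b := Real.sqrt (r ^ 2 - a ^ 2)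
    set e : ℂ := (w - z) / d with he
    have hen : ‖e‖ = 1 := by
      rw [he, norm_div, norm_sub_rev, ← hdd, Complex.norm_real, Real.norm_eq_abs,
        abs_of_pos hd0, div_self hd0.ne']
    have hed : w = z + e * d := by rw [he]; field_simp; ring
    refine ⟨z + e * (⟨a, b⟩ : ℂ), ?_, ?_⟩
    · rw [add_sub_cancel_left, norm_mul, hen, one_mul, Complex.norm_eq_sqrt_sq_add_sq]
      simp only
      rw [hbs, add_sub_cancel, Real.sqrt_sq hu.le]
    · have : z + e * (⟨a, b⟩ : ℂ) - w = e * (⟨a - d, b⟩ : ℂ) := by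
        have : (⟨a - d, b⟩ : ℂ) = (⟨a, b⟩ : ℂ) - (d : ℂ) := by
          apply Complex.ext <;> simp
        rw [this]
        conv_lhs => rw [hed]
        ring
      rw [this, norm_mul, hen, one_mul, Complex.norm_eq_sqrt_sq_add_sq]
      simp only
      rw [hbs, show (a - d) ^ 2 + (r ^ 2 - a ^ 2) = s ^ 2 by nlinarith, Real.sqrt_sq hv.le]

theorem Flat.pos {p : E3 × E3} (h : Flat p) : 0 < (pl p).2 := abs_pos.2 h.2.2

theorem dj_of_disjoint {p q : E3 × E3} (hp : Flat p) (hq : Flat q)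
    (h : Disjoint (pCircle p) (pCircle q)) : p.1 0 ≠ q.1 0 ∨ Dj (pl p) (pl q) := by
  by_contra hc
  push Not at hc
  obtain ⟨h0, hd⟩ := hc
  obtain ⟨y, y1, y2⟩ := exists_inter _ _ hp.pos hq.pos hd
  have hy : pr (!₂[p.1 0, y.re, y.im] : E3) = y := by apply Complex.ext <;> simp [pr]
  refine (Set.disjoint_left.1 h : ∀ ⦃a⦄, a ∈ pCircle p → a ∉ pCircle q)
    (a := (!₂[p.1 0, y.re, y.im] : E3)) ?_ ?_
  · rw [mem_circle hp, hy]; exact ⟨by simp, y1⟩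
  · rw [mem_circle hq, hy]; exact ⟨by simp [h0], y2⟩

theorem dj_ne (u v : ℂ × ℝ) (h : Dj u v) (y : ℂ) (h1 : ‖y - u.1‖ = u.2) : ‖y - v.1‖ ≠ v.2 := by
  intro h2
  have t1 := norm_sub_le_norm_sub_add_norm_sub u.1 y v.1
  have t2 := norm_sub_le_norm_sub_add_norm_sub y u.1 v.1
  have t3 := norm_sub_le_norm_sub_add_norm_sub y v.1 u.1
  rw [norm_sub_rev u.1 y] at t1
  rw [norm_sub_rev v.1 u.1] at t3
  rcases h with h | h | h
  · unfold Apart at h; linarith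
  · unfold Nst at h; linarith
  · unfold Nst at h; rw [norm_sub_rev v.1 u.1] at h; linarith

theorem disjoint_of_dj {p q : E3 × E3} (hp : Flat p) (hq : Flat q)
    (h : p.1 0 ≠ q.1 0 ∨ Dj (pl p) (pl q)) : Disjoint (pCircle p) (pCircle q) := by
  rw [Set.disjoint_left]
  intro x h1 h2
  rw [mem_circle hp] at h1
  rw [mem_circle hq] at h2
  rcases h with h | h
  · exact h (h1.1.symm.trans h2.1)
  · exact dj_ne _ _ h _ h1.2 h2.2

theorem not_links {p q : E3 × E3} (hp : Flat p) (hq : Flat q)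
    (h : p.1 0 ≠ q.1 0 ∨ Dj (pl p) (pl q)) : ¬ LinksOnce p q := by
  rintro ⟨x, ⟨h1, h2⟩, hu⟩
  rw [mem_circle hp] at h1
  rw [mem_disk hq] at h2
  have h0 : p.1 0 = q.1 0 := h1.1.symm.trans h2.1
  have t1 := norm_sub_le_norm_sub_add_norm_sub (pl p).1 (pr x) (pl q).1
  rw [norm_sub_rev (pl p).1 (pr x)] at t1
  have t3 := norm_sub_le_norm_sub_add_norm_sub (pr x) (pl q).1 (pl p).1
  have hpp := hp.pos
  rcases h with h | h | h | h
  · exact h h0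
  · unfold Apart at h; linarith
  · have key : ∀ y : ℂ, ‖y - (pl p).1‖ = (pl p).2 → y = pr x := by
      intro y hy
      have e : pr (!₂[p.1 0, y.re, y.im] : E3) = y := by apply Complex.ext <;> simp [pr]
      have := hu (!₂[p.1 0, y.re, y.im] : E3) ⟨by rw [mem_circle hp, e]; exact ⟨by simp, hy⟩, by
        rw [mem_disk hq, e]
        refine ⟨by simp [h0], ?_⟩
        have := norm_sub_le_norm_sub_add_norm_sub y (pl p).1 (pl q).1
        unfold Nst at h; linarith⟩
      rw [← this, e]
    have k1 := key ((pl p).1 + ((pl p).2 : ℂ)) (by simp [abs_of_pos hpp])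
    have k2 := key ((pl p).1 - ((pl p).2 : ℂ)) (by simp [abs_of_pos hpp])
    have := congrArg Complex.re (k1.trans k2.symm)
    simp at this
    linarith
  · unfold Nst at h; linarith

theorem ring_iff {n : ℕ} (f : Fin n → E3 × E3) (hf : ∀ i, Flat (f i)) :
    IsRingTuple f ↔ ∀ i j, i ≠ j → (f i).1 0 ≠ (f j).1 0 ∨ Dj (pl (f i)) (pl (f j)) := by
  constructor
  · intro h i j hij
    exact dj_of_disjoint (hf i) (hf j) (h.2.1 i j hij)
  · intro h
    refine ⟨fun i h0 => (hf i).2.2 (by simp [h0]), fun i j hij =>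
      disjoint_of_dj (hf i) (hf j) (h i j hij), fun i j hij =>
      ⟨not_links (hf i) (hf j) (h i j hij), not_links (hf j) (hf i) (h j i hij.symm)⟩⟩

theorem pur_flat {n : ℕ} (f : PURTuple n) (i : Fin n) : Flat (f.1.1 i) := by
  refine ⟨(f.2 i).1, (f.2 i).2, fun h => f.1.2.1 i ?_⟩
  ext k
  fin_cases k
  · simpa using h
  · simpa using (f.2 i).1
  · simpa using (f.2 i).2

theorem continuous_coord (k : Fin 3) : Continuous fun x : E3 => x k := by fun_prop

theorem continuous_pr : Continuous pr := by
  have : pr = fun x : E3 => Complex.equivRealProdCLM.symm (x 1, x 2) := by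
    funext x; apply Complex.ext <;> simp [pr]
  rw [this]
  exact Complex.equivRealProdCLM.symm.continuous.comp
    ((continuous_coord 1).prodMk (continuous_coord 2))

theorem continuous_pl : Continuous pl :=
  (continuous_pr.comp continuous_fst).prodMk
    (((continuous_coord 0).comp continuous_snd).abs)

theorem continuous_param {n : ℕ} (i : Fin n) : Continuous fun f : PURTuple n => f.1.1 i :=
  (continuous_apply i).comp (continuous_subtype_val.comp continuous_subtype_val)

/-- The comparison map. -/
def toC (n : ℕ) : C(PURTuple n, Conf n) where
  toFun f := ⟨(fun i => (f.1.1 i).1 0, fun i => pl (f.1.1 i)),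
    fun i => (pur_flat f i).pos, (ring_iff _ (pur_flat f)).1 f.1.2⟩
  continuous_toFun := by
    refine Continuous.subtype_mk (Continuous.prodMk (continuous_pi fun i => ?_)
      (continuous_pi fun i => ?_)) _
    · exact (continuous_coord 0).comp (continuous_fst.comp (continuous_param i))
    · exact continuous_pl.comp (continuous_param i)

/-- The parameters of the section. -/
def secP {n : ℕ} (s : Fin n → ℝ) (q : Amb n) (i : Fin n) : E3 × E3 :=
  (!₂[q.1 i, (q.2 i).1.re, (q.2 i).1.im], !₂[s i * (q.2 i).2, 0, 0])

theorem secP_flat {n : ℕ} (s : Fin n → ℝ) (hs : ∀ i, |s i| = 1) (q : Conf n) (i : Fin n) :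
    Flat (secP s q.1 i) := by
  have : s i ≠ 0 := fun h => by have := hs i; rw [h] at this; simp at this
  refine ⟨by simp [secP], by simp [secP], ?_⟩
  have := (q.2.1 i).ne'
  simp [secP, *]

theorem secP_pl {n : ℕ} (s : Fin n → ℝ) (hs : ∀ i, |s i| = 1) (q : Conf n) (i : Fin n) :
    pl (secP s q.1 i) = q.1.2 i := by
  apply Prod.ext
  · apply Complex.ext <;> simp [secP, pl, pr]
  · simp [secP, pl, abs_mul, hs i, abs_of_pos (q.2.1 i)]

/-- The section of the comparison map with prescribed signs. -/
def secC {n : ℕ} (s : Fin n → ℝ) (hs : ∀ i, |s i| = 1) : C(Conf n, PURTuple n) where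
  toFun q := ⟨⟨secP s q.1, (ring_iff _ (secP_flat s hs q)).2 fun i j hij => by
    rw [secP_pl s hs, secP_pl s hs]
    simpa [secP] using q.2.2 i j hij⟩, fun i => ⟨by simp [secP], by simp [secP]⟩⟩
  continuous_toFun := by
    apply Continuous.subtype_mk
    apply Continuous.subtype_mk
    refine continuous_pi fun i => ?_
    unfold secP
    refine Continuous.prodMk ?_ ?_
    · refine (PiLp.continuous_toLp 2 _).comp (continuous_pi fun k => ?_)
      fin_cases k <;> simp <;> fun_prop
    · refine (PiLp.continuous_toLp 2 _).comp (continuous_pi fun k => ?_)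
      fin_cases k <;> simp <;> fun_prop

theorem toC_secC {n : ℕ} (s : Fin n → ℝ) (hs : ∀ i, |s i| = 1) (q : Conf n) :
    toC n (secC s hs q) = q := by
  apply Subtype.ext
  apply Prod.ext
  · funext i
    change (secP s q.1 i).1 0 = _
    simp [secP]
  · funext i
    exact secP_pl s hs q i

theorem secC_toC {n : ℕ} (s : Fin n → ℝ) (hs : ∀ i, |s i| = 1) (f : PURTuple n)
    (h : ∀ i, 0 < s i * (f.1.1 i).2 0) : secC s hs (toC n f) = f := by
  apply Subtype.ext
  apply Subtype.ext
  funext i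
  change secP s (toC n f).1 i = _
  have key : s i * |(f.1.1 i).2 0| = (f.1.1 i).2 0 := by
    have h1 : |(f.1.1 i).2 0| = s i * (f.1.1 i).2 0 := by
      rw [← abs_of_pos (h i), abs_mul, hs i, one_mul]
    have h2 : s i * s i = 1 := by rw [← abs_mul_abs_self, hs i, one_mul]
    rw [h1, ← mul_assoc, h2, one_mul]
  apply Prod.ext
  · ext k
    fin_cases k <;> simp [secP, toC, pl, pr]
  · ext k
    fin_cases k
    · simpa [secP, toC, pl] using key
    · simpa [secP] using (f.2 i).1.symm
    · simpa [secP] using (f.2 i).2.symm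

theorem pur_iso (n : ℕ) (x : PURTuple n) :
    Nonempty (FundamentalGroup (PURTuple n) x ≃* PresentedGroup (purRels n)) := by
  obtain ⟨e⟩ := conf_iso (toC n x)
  set s : Fin n → ℝ := fun i => (x.1.1 i).2 0 / |(x.1.1 i).2 0| with hsdef
  have hne : ∀ i, |(x.1.1 i).2 0| ≠ 0 := fun i => (pur_flat x i).pos.ne'
  have hs : ∀ i, |s i| = 1 := fun i => by simp only [s]; rw [abs_div, abs_abs, div_self (hne i)]
  have hx : ∀ i, 0 < s i * (x.1.1 i).2 0 := fun i => by
    have := (pur_flat x i).2.2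
    have h2 : 0 < (x.1.1 i).2 0 * (x.1.1 i).2 0 := mul_self_pos.2 this
    simp only [s]
    rw [div_mul_eq_mul_div]
    positivity
  have hb := map_bij (toC n) (secC s hs) x (toC_secC s hs) (secC_toC s hs x hx) (by
    intro γ t
    apply secC_toC
    intro i
    by_contra hc
    push Not at hc
    have hcont : Continuous fun t : I => s i * ((γ t).1.1 i).2 0 :=
      continuous_const.mul ((continuous_coord 0).comp
        (continuous_snd.comp ((continuous_param i).comp γ.continuous)))
    have h0 : (0 : ℝ) ∈ Set.range fun t : I => s i * ((γ t).1.1 i).2 0 := by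
      refine (isPreconnected_range hcont).ordConnected.out ⟨t, rfl⟩ ⟨0, rfl⟩ ⟨hc, ?_⟩
      simpa using (hx i).le
    obtain ⟨t', ht'⟩ := h0
    have h1 : s i ≠ 0 := fun h => by have := hs i; rw [h] at this; simp at this
    exact (mul_ne_zero h1 (pur_flat (γ t') i).2.2) ht')
  exact ⟨(MulEquiv.ofBijective _ hb).trans e⟩

end RingModel

/-- McCool's presentation: the fundamental group of the ordered untwisted ring space
`𝒫𝒰ℛ_n` is isomorphic to the group presented by the generators `α_{ij}` (`i ≠ j`) with
the relations above. -/
theorem statement12 (n : ℕ) (x : PURTuple n) :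
    Nonempty (FundamentalGroup (PURTuple n) x ≃* PresentedGroup (purRels n)) := by
  exact RingModel.pur_iso n x
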